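/- arXiv:2311.01374 — 8 statements merged into one kernel-verified Lean document; each statement's English description precedes it below -/
import Mathlib

section
/- Let F : [0,∞) × ℝ → ℝ be continuous. Then there exist a with 0 < a ≤ ∞ and a function y : [0,a) → ℝ such that y(0) = 0, y is differentiable on [0,a) (with one-sided derivative at 0) and y′(x) = F(x, y(x)) for all x ∈ [0,a), and if a < ∞ then y(x) tends to +∞ or to −∞ as x → a⁻. -/
open Set Filter Topology

/-- Nodes of the explicit Euler scheme with step `h` for the autonomous equation `z' = G z`. -/
noncomputable def eulerNode {E : Type*} [AddCommGroup E] [Module ℝ E]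
    (G : E → E) (h : ℝ) (z₀ : E) : ℕ → E
  | 0 => z₀
  | k + 1 => eulerNode G h z₀ k + h • G (eulerNode G h z₀ k)

section Peano

variable {E : Type*} [NormedAddCommGroup E] [NormedSpace ℝ E]

/-- If the slopes used between nodes `i` and `j` are `ε`-close to `v`, the Euler scheme
stays close to the line with slope `v`. -/
theorem norm_eulerNode_sub_sub_smul_le (G : E → E) {h : ℝ} (hh : 0 ≤ h) (z₀ v : E) {ε : ℝ}
    {i j : ℕ} (hij : i ≤ j)
    (hv : ∀ k, i ≤ k → k < j → ‖G (eulerNode G h z₀ k) - v‖ ≤ ε) :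
    ‖eulerNode G h z₀ j - eulerNode G h z₀ i - (j * h - i * h) • v‖ ≤ ε * (j * h - i * h) := by
  induction j, hij using Nat.le_induction with
  | base => simp
  | succ j hij ih =>
    have h1 := ih fun k hk hkj => hv k hk (hkj.trans j.lt_succ_self)
    have h2 := hv j hij j.lt_succ_self
    have h3 : eulerNode G h z₀ (j + 1) - eulerNode G h z₀ i - ((j + 1 : ℕ) * h - i * h) • v =
        (eulerNode G h z₀ j - eulerNode G h z₀ i - (j * h - i * h) • v) +
          h • (G (eulerNode G h z₀ j) - v) := by
      rw [eulerNode]; push_cast; module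
    have h4 : ‖h • (G (eulerNode G h z₀ j) - v)‖ ≤ h * ε := by
      rw [norm_smul, Real.norm_of_nonneg hh]
      gcongr
    rw [h3]
    refine (norm_add_le _ _).trans ((add_le_add h1 h4).trans (le_of_eq ?_))
    push_cast; ring

/-- The Euler scheme moves with speed at most one if the slopes are bounded by one. -/
theorem norm_eulerNode_sub_le {G : E → E} (hG : ∀ z, ‖G z‖ ≤ 1) {h : ℝ} (hh : 0 ≤ h) (z₀ : E)
    {i j : ℕ} (hij : i ≤ j) :
    ‖eulerNode G h z₀ j - eulerNode G h z₀ i‖ ≤ j * h - i * h := by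
  simpa using norm_eulerNode_sub_sub_smul_le G hh z₀ 0 (ε := 1) hij fun k _ _ => by
    simpa using hG _

/-- **Peano existence theorem** for a bounded autonomous equation in a proper space. -/
theorem exists_hasDerivWithinAt_of_continuous_of_norm_le_one [ProperSpace E] {G : E → E}
    (hGc : Continuous G) (hG : ∀ z, ‖G z‖ ≤ 1) (z₀ : E) :
    ∃ z : ℝ → E, z 0 = z₀ ∧ ∀ t, 0 ≤ t → HasDerivWithinAt z (G (z t)) (Ici 0) t := by
  let U : Ultrafilter ℕ := hyperfilter ℕ
  let h : ℕ → ℝ := fun n => 1 / ((n : ℝ) + 1)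
  have hpos : ∀ n, 0 < h n := fun n => Nat.one_div_pos_of_nat
  have hlim : Tendsto h U (𝓝 0) :=
    tendsto_one_div_add_atTop_nhds_zero_nat.mono_left Nat.hyperfilter_le_atTop
  let m : ℕ → ℝ → ℕ := fun n t => ⌊t / h n⌋₊
  have hm_mono : ∀ n {s t : ℝ}, s ≤ t → m n s ≤ m n t := fun n s t hst =>
    Nat.floor_mono (div_le_div_of_nonneg_right hst (hpos n).le)
  have hm_le : ∀ n {t : ℝ}, 0 ≤ t → m n t * h n ≤ t := fun n t ht =>
    (le_div_iff₀ (hpos n)).1 (Nat.floor_le (div_nonneg ht (hpos n).le))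
  have hm_gt : ∀ n (t : ℝ), t - h n < m n t * h n := fun n t => by
    have := (div_lt_iff₀ (hpos n)).1 (Nat.lt_floor_add_one (t / h n))
    change t < (m n t + 1) * h n at this
    linarith
  have hm_lim : ∀ t : ℝ, 0 ≤ t → Tendsto (fun n => m n t * h n) U (𝓝 t) := fun t ht => by
    refine tendsto_of_tendsto_of_tendsto_of_le_of_le (g := fun n => t - h n) ?_
      tendsto_const_nhds (fun n => (hm_gt n t).le) fun n => hm_le n ht
    simpa using hlim.const_sub t
  let p : ℕ → ℝ → E := fun n t => eulerNode G (h n) z₀ (m n t)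
  have hex : ∀ t : ℝ, ∃ z, 0 ≤ t → Tendsto (fun n => p n t) U (𝓝 z) := fun t => by
    by_cases ht : 0 ≤ t
    · have hmem : ∀ n, p n t ∈ Metric.closedBall z₀ t := fun n => by
        rw [mem_closedBall_iff_norm]
        have := norm_eulerNode_sub_le hG (hpos n).le z₀ (Nat.zero_le (m n t))
        simp only [eulerNode, Nat.cast_zero, zero_mul, sub_zero] at this
        exact this.trans (hm_le n ht)
      obtain ⟨z, -, hz⟩ := (isCompact_closedBall z₀ t).ultrafilter_le_nhds
        (U.map fun n => p n t) (by
          rw [le_principal_iff]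
          exact Filter.mem_map.2 (Eventually.of_forall hmem))
      exact ⟨z, fun _ => hz⟩
    · exact ⟨z₀, fun h => absurd h ht⟩
  choose z hz using hex
  have hlip : ∀ s t, 0 ≤ s → s ≤ t → ‖z t - z s‖ ≤ t - s := fun s t hs hst =>
    le_of_tendsto_of_tendsto (((hz t (hs.trans hst)).sub (hz s hs)).norm)
      ((hm_lim t (hs.trans hst)).sub (hm_lim s hs))
      (Eventually.of_forall fun n => norm_eulerNode_sub_le hG (hpos n).le z₀ (hm_mono n hst))
  have hlip' : ∀ s t, 0 ≤ s → 0 ≤ t → ‖z s - z t‖ ≤ |s - t| := fun s t hs ht => by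
    rcases le_total s t with hst | hst
    · rw [norm_sub_rev, abs_sub_comm]
      exact (hlip s t hs hst).trans (le_abs_self _)
    · exact (hlip t s ht hst).trans (le_abs_self _)
  have hkey : ∀ t, 0 ≤ t → ∀ ε > 0, ∃ δ > 0, ∀ s s', 0 ≤ s → s ≤ s' → |s - t| < δ →
      |s' - t| < δ → ‖z s' - z s - (s' - s) • G (z t)‖ ≤ ε * (s' - s) := fun t ht ε hε => by
    obtain ⟨δ, hδ, hδG⟩ := Metric.continuous_iff.1 hGc (z t) ε hε
    refine ⟨δ / 8, by positivity, fun s s' hs hss hst hst' => ?_⟩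
    have hs' := hs.trans hss
    have e1 : ∀ᶠ n in (U : Filter ℕ), h n < δ / 8 := hlim.eventually_lt_const (by positivity)
    have e2 : ∀ᶠ n in (U : Filter ℕ), dist (p n s) (z s) < δ / 8 :=
      (hz s hs).eventually (Metric.ball_mem_nhds _ (by positivity))
    refine le_of_tendsto_of_tendsto
      (((hz s' hs').sub (hz s hs)).sub (((hm_lim s' hs').sub (hm_lim s hs)).smul_const _)).norm
      (((hm_lim s' hs').sub (hm_lim s hs)).const_mul ε) ?_
    filter_upwards [e1, e2] with n hn1 hn2
    refine norm_eulerNode_sub_sub_smul_le G (hpos n).le z₀ _ (hm_mono n hss) fun k hik hkj => ?_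
    rw [← dist_eq_norm]
    refine (hδG _ ?_).le
    have h1 : dist (eulerNode G (h n) z₀ k) (p n s) ≤ k * h n - m n s * h n := by
      rw [dist_eq_norm]; exact norm_eulerNode_sub_le hG (hpos n).le z₀ hik
    have h2 : (k : ℝ) * h n ≤ m n s' * h n := by
      have := hpos n
      gcongr
    have h3 : dist (z s) (z t) ≤ |s - t| := by rw [dist_eq_norm]; exact hlip' s t hs ht
    have h4 := dist_triangle4 (eulerNode G (h n) z₀ k) (p n s) (z s) (z t)
    have h5 := hm_le n hs'
    have h6 := hm_gt n s
    have h7 := neg_lt_of_abs_lt hst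
    have h8 := lt_of_abs_lt hst'
    linarith
  refine ⟨z, ?_, fun t ht => ?_⟩
  · refine tendsto_nhds_unique (hz 0 le_rfl) ?_
    have : ∀ n, p n 0 = z₀ := fun n => by simp [p, m, eulerNode]
    simp [this]
  · rw [hasDerivWithinAt_iff_isLittleO, Asymptotics.isLittleO_iff]
    intro ε hε
    obtain ⟨δ, hδ, hk⟩ := hkey t ht ε hε
    filter_upwards [mem_nhdsWithin_of_mem_nhds (Metric.ball_mem_nhds t hδ), self_mem_nhdsWithin]
      with x hx hx0
    rw [Metric.mem_ball, Real.dist_eq] at hx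
    have htt : |t - t| < δ := by simpa using hδ
    rcases le_total t x with htx | htx
    · rw [Real.norm_of_nonneg (sub_nonneg.2 htx)]
      exact hk t x ht htx htt hx
    · have := hk x t hx0 htx hx htt
      rwa [Real.norm_eq_abs, abs_sub_comm, abs_of_nonneg (sub_nonneg.2 htx), ← norm_neg,
        show -(z x - z t - (x - t) • G (z t)) = z t - z x - (t - x) • G (z t) by module]

end Peano

/-- Inverse function rule, within intervals, for a strictly increasing function. -/
theorem StrictMonoOn.hasDerivWithinAt_rightInverse {f g : ℝ → ℝ} {s t : Set ℝ} [s.OrdConnected]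
    [t.OrdConnected] (hf : StrictMonoOn f s) (hst : f '' s = t) (hg : MapsTo g t s)
    (hfg : RightInvOn g f t) {x f' : ℝ} (hx : x ∈ t) (hf' : f' ≠ 0)
    (h : HasDerivWithinAt f f' s (g x)) : HasDerivWithinAt g f'⁻¹ t x := by
  have hmono : StrictMono (s.domRestrict f) := fun a b hab => hf a.2 b.2 hab
  have hrange : (range (s.domRestrict f)).OrdConnected := by
    rwa [range_domRestrict, hst]
  have hcont : Continuous (hg.restrict g t s) := by
    rw [(hmono.isEmbedding_of_ordConnected hrange).continuous_iff]
    exact continuous_subtype_val.congr fun y => (hfg y.2).symm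
  have hgc : ContinuousOn g t :=
    continuousOn_iff_continuous_domRestrict.2 (continuous_subtype_val.comp hcont)
  exact HasFDerivWithinAt.of_local_left_inverse
    (f' := ContinuousLinearEquiv.unitsEquivAut ℝ (Units.mk0 f' hf'))
    (tendsto_nhdsWithin_of_tendsto_nhds_of_eventually_within _ (hgc x hx)
      (eventually_mem_nhdsWithin.mono fun _ hy => hg hy)) h hx
    (eventually_mem_nhdsWithin.mono fun _ hy => hfg hy)

/-- Mean value theorem on a half-line, for one-sided derivatives at the endpoint. -/
theorem exists_slope_eq_of_hasDerivWithinAt_Ici {f f' : ℝ → ℝ} {a : ℝ}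
    (h : ∀ t, a ≤ t → HasDerivWithinAt f (f' t) (Ici a) t) {s t : ℝ} (hs : a ≤ s) (hst : s < t) :
    ∃ c ∈ Ioo s t, f t - f s = f' c * (t - s) := by
  obtain ⟨c, hc, hc'⟩ := exists_hasDerivAt_eq_slope f f' hst
    (fun u hu => ((h u (hs.trans hu.1)).continuousWithinAt).mono
      fun v hv => hs.trans hv.1)
    fun u hu => (h u (hs.trans hu.1.le)).hasDerivAt (Ici_mem_nhds (hs.trans_lt hu.1))
  exact ⟨c, hc, by rw [hc', div_mul_cancel₀ _ (sub_pos.2 hst).ne']⟩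

/-- A continuous function on a half-line whose absolute value tends to infinity tends to `∞` or
to `-∞`. -/
theorem tendsto_atTop_or_atBot_of_tendsto_abs {f : ℝ → ℝ} {a : ℝ} (hf : ContinuousOn f (Ici a))
    (h : Tendsto (fun t => |f t|) atTop atTop) :
    Tendsto f atTop atTop ∨ Tendsto f atTop atBot := by
  obtain ⟨T, hT⟩ := eventually_atTop.1 (h.eventually_gt_atTop 0)
  have hne : ∀ t ∈ Ici (max a T), f t ≠ 0 := fun t ht =>
    abs_pos.1 (hT t ((le_max_right _ _).trans ht))
  have hc : ContinuousOn f (Ici (max a T)) := hf.mono (Ici_subset_Ici.2 (le_max_left _ _))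
  have hev : ∀ᶠ t in atTop, t ∈ Ici (max a T) := eventually_ge_atTop _
  have h0 : max a T ∈ Ici (max a T) := self_mem_Ici
  have hzero : (0 : ℝ) ∉ f '' Ici (max a T) := fun ⟨t, ht, h⟩ => hne t ht h
  rcases (hne _ h0).lt_or_gt with hneg | hpos
  · refine Or.inr (tendsto_neg_atTop_iff.1 (h.congr' ?_))
    filter_upwards [hev] with t ht
    refine abs_of_neg (not_le.1 fun hle => hzero ?_)
    exact isPreconnected_Ici.intermediate_value h0 ht hc ⟨hneg.le, hle⟩
  · refine Or.inl (h.congr' ?_)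
    filter_upwards [hev] with t ht
    refine abs_of_pos (not_le.1 fun hle => hzero ?_)
    exact isPreconnected_Ici.intermediate_value ht h0 hc ⟨hle, hpos.le⟩

/-- **Global Peano existence theorem** (Theorem 4.1).
Let `F : [0,∞) × ℝ → ℝ` be continuous. Then there exist `a` with `0 < a ≤ ∞` and a
function `y : [0,a) → ℝ` such that `y 0 = 0`, `y` is differentiable on `[0,a)`
(one-sided derivative at `0`) with `y' x = F (x, y x)` for all `x ∈ [0,a)`,
and if `a < ∞` then `y x → +∞` or `y x → -∞` as `x → a⁻`. -/
theorem global_peano (F : ℝ × ℝ → ℝ)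
    (hF : ContinuousOn F (Set.Ici (0 : ℝ) ×ˢ (Set.univ : Set ℝ))) :
    ∃ (a : EReal) (y : ℝ → ℝ), 0 < a ∧
      y 0 = 0 ∧
      (∀ x : ℝ, 0 ≤ x → (x : EReal) < a →
        HasDerivWithinAt y (F (x, y x)) {t : ℝ | 0 ≤ t ∧ (t : EReal) < a} x) ∧
      (∀ ar : ℝ, a = (ar : EReal) →
        Filter.Tendsto y (nhdsWithin ar (Set.Iio ar)) Filter.atTop ∨
        Filter.Tendsto y (nhdsWithin ar (Set.Iio ar)) Filter.atBot) := by
  let H : ℝ × ℝ → ℝ := fun p => F (max 0 p.1, p.2)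
  have hH : Continuous H := hF.comp_continuous (by fun_prop) fun p =>
    ⟨le_max_left (0 : ℝ) p.1, trivial⟩
  have hden : ∀ p, 0 < 1 + |H p| := fun p => by positivity
  let G : ℝ × ℝ → ℝ × ℝ := fun p => (1 / (1 + |H p|), H p / (1 + |H p|))
  have hGc : Continuous G :=
    (continuous_const.div (by fun_prop) fun p => (hden p).ne').prodMk
      (hH.div (by fun_prop) fun p => (hden p).ne')
  have hG1 : ∀ p, 0 < (G p).1 := fun p => one_div_pos.2 (hden p)
  have hG2 : ∀ p, |(G p).2| ≤ 1 := fun p => by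
    simp only [G, abs_div, abs_of_pos (hden p)]
    rw [div_le_one (hden p)]
    linarith
  have hG : ∀ p, ‖G p‖ ≤ 1 := fun p => by
    refine (Prod.norm_def _).trans_le (max_le ?_ (hG2 p))
    rw [Real.norm_of_nonneg (hG1 p).le]
    exact (div_le_one (hden p)).2 (by linarith [abs_nonneg (H p)])
  obtain ⟨z, hz0, hz⟩ := exists_hasDerivWithinAt_of_continuous_of_norm_le_one hGc hG 0
  let X : ℝ → ℝ := fun t => (z t).1
  let Y : ℝ → ℝ := fun t => (z t).2
  have hX0 : X 0 = 0 := by simp [X, hz0]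
  have hY0 : Y 0 = 0 := by simp [Y, hz0]
  have hX : ∀ t, 0 ≤ t → HasDerivWithinAt X (G (z t)).1 (Ici 0) t := fun t ht => by
    simpa using (hz t ht).hasFDerivWithinAt.fst.hasDerivWithinAt
  have hY : ∀ t, 0 ≤ t → HasDerivWithinAt Y (G (z t)).2 (Ici 0) t := fun t ht => by
    simpa using (hz t ht).hasFDerivWithinAt.snd.hasDerivWithinAt
  have hXc : ContinuousOn X (Ici 0) := fun t ht => (hX t ht).continuousWithinAt
  have hYc : ContinuousOn Y (Ici 0) := fun t ht => (hY t ht).continuousWithinAt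
  have hXmono : StrictMonoOn X (Ici 0) := fun s hs t _ hst => by
    obtain ⟨c, -, hc⟩ := exists_slope_eq_of_hasDerivWithinAt_Ici hX hs hst
    have := mul_pos (hG1 (z c)) (sub_pos.2 hst)
    linarith
  have hXnonneg : ∀ t, 0 ≤ t → 0 ≤ X t := fun t ht =>
    hX0.symm.le.trans (hXmono.monotoneOn self_mem_Ici ht ht)
  let a : EReal := sSup ((fun t => (X t : EReal)) '' Ici 0)
  have hXa : ∀ t, 0 ≤ t → (X t : EReal) < a := fun t ht => by
    have h1 : (0 : ℝ) ≤ t + 1 := by linarith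
    exact (EReal.coe_lt_coe_iff.2 (hXmono ht h1 (lt_add_one t))).trans_le
      (le_sSup (mem_image_of_mem _ h1))
  let D : Set ℝ := {t : ℝ | 0 ≤ t ∧ (t : EReal) < a}
  have hD : X '' Ici 0 = D := by
    refine Subset.antisymm ?_ fun x hx => ?_
    · rintro _ ⟨t, ht, rfl⟩
      exact ⟨hXnonneg t ht, hXa t ht⟩
    · obtain ⟨_, ⟨t, ht, rfl⟩, hxt⟩ := lt_sSup_iff.1 hx.2
      obtain ⟨s, hs, rfl⟩ := intermediate_value_Icc (mem_Ici.1 ht) (hXc.mono Icc_subset_Ici_self)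
        ⟨hX0.trans_le hx.1, (EReal.coe_lt_coe_iff.1 hxt).le⟩
      exact mem_image_of_mem _ hs.1
  have hDord : D.OrdConnected := ⟨fun x hx y hy w hw =>
    ⟨hx.1.trans hw.1, (EReal.coe_le_coe_iff.2 hw.2).trans_lt hy.2⟩⟩
  let g : ℝ → ℝ := Function.invFunOn X (Ici 0)
  have hsurj : SurjOn X (Ici 0) D := hD.superset
  have hgD : MapsTo g D (Ici 0) := hsurj.mapsTo_invFunOn
  have hXg : RightInvOn g X D := hsurj.rightInvOn_invFunOn
  have hgX : ∀ t, 0 ≤ t → g (X t) = t := fun t ht => hXmono.injOn.leftInvOn_invFunOn ht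
  refine ⟨a, Y ∘ g, ?_, ?_, fun x hx0 hxa => ?_, fun r hr => ?_⟩
  · simpa [hX0] using hXa 0 le_rfl
  · rw [Function.comp_apply, ← hX0, hgX 0 le_rfl, hY0, hX0]
  · have hx : x ∈ D := ⟨hx0, hxa⟩
    have hgx : 0 ≤ g x := hgD hx
    have hd := (hY _ hgx).comp x (hXmono.hasDerivWithinAt_rightInverse hD hgD hXg hx
      (hG1 _).ne' (hX _ hgx)) hgD
    have hHF : H (z (g x)) = F (x, Y (g x)) := by
      change F (max 0 (X (g x)), Y (g x)) = _
      rw [hXg hx, max_eq_right hx0]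
    have hquot : (G (z (g x))).2 * ((G (z (g x))).1)⁻¹ = F (x, (Y ∘ g) x) := by
      change H (z (g x)) / (1 + |H (z (g x))|) * (1 / (1 + |H (z (g x))|))⁻¹ = F (x, Y (g x))
      rw [← hHF, one_div, inv_inv, div_mul_cancel₀ _ (hden _).ne']
    exact hquot ▸ hd
  · have hXr : ∀ t, 0 ≤ t → X t < r := fun t ht => EReal.coe_lt_coe_iff.1 (hr ▸ hXa t ht)
    have hgr : Tendsto g (𝓝[<] r) atTop := by
      refine tendsto_atTop.2 fun T => ?_
      have hT : (0 : ℝ) ≤ max T 0 := le_max_right _ _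
      filter_upwards [Ioo_mem_nhdsLT (hXr _ hT)] with x hx
      have hxD : x ∈ D := ⟨(hXnonneg _ hT).trans hx.1.le, hr ▸ EReal.coe_lt_coe_iff.2 hx.2⟩
      have := (hXmono.lt_iff_lt hT (hgD hxD)).1 (hx.1.trans_eq (hXg hxD).symm)
      exact (le_max_left _ _).trans this.le
    have hYabs : Tendsto (fun t => |Y t|) atTop atTop := by
      refine tendsto_atTop.2 fun K => ?_
      obtain ⟨B, hB⟩ := (isCompact_Icc.prod (isCompact_Icc (a := -(K + 1)) (b := K + 1))
        : IsCompact (Icc 0 r ×ˢ Icc (-(K + 1)) (K + 1))).exists_bound_of_continuousOn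
          hH.continuousOn
      let c : ℝ := 1 / (1 + max B 0)
      have hc : 0 < c := by positivity
      obtain ⟨_, ⟨T, hT, rfl⟩, hrT⟩ := lt_sSup_iff.1
        (show ((r - c : ℝ) : EReal) < a from hr ▸ EReal.coe_lt_coe_iff.2 (sub_lt_self r hc))
      filter_upwards [eventually_ge_atTop T] with t ht
      by_contra! hK
      have ht0 : 0 ≤ t := le_trans hT ht
      obtain ⟨u, hu, hXu⟩ := exists_slope_eq_of_hasDerivWithinAt_Ici hX ht0 (lt_add_one t)
      have hu0 : 0 ≤ u := ht0.trans hu.1.le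
      obtain ⟨v, -, hYv⟩ := exists_slope_eq_of_hasDerivWithinAt_Ici hY ht0 hu.1
      have hYu : |Y u| ≤ K + 1 := by
        have h1 : |Y u - Y t| ≤ 1 := by
          rw [hYv, abs_mul, abs_of_pos (sub_pos.2 hu.1)]
          exact mul_le_one₀ (hG2 _) (sub_pos.2 hu.1).le (by linarith [hu.2])
        have h2 := abs_add_le (Y u - Y t) (Y t)
        rw [sub_add_cancel] at h2
        linarith
      have hHu : |H (z u)| ≤ max B 0 :=
        (hB (z u) ⟨⟨hXnonneg u hu0, (hXr u hu0).le⟩, abs_le.1 hYu⟩).trans (le_max_left _ _)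
      have hcu : c ≤ (G (z u)).1 :=
        one_div_le_one_div_of_le (hden _) (by linarith)
      have hXT : X T ≤ X t := hXmono.monotoneOn hT ht0 ht
      have h3 := hXr (t + 1) (by linarith)
      have h4 := EReal.coe_lt_coe_iff.1 hrT
      rw [add_sub_cancel_left, mul_one] at hXu
      linarith
    exact (tendsto_atTop_or_atBot_of_tendsto_abs hYc hYabs).imp (·.comp hgr) (·.comp hgr)
end

section
/- Let F : ℝ² → ℝ be continuous and let (a, b) ∈ ℝ². Then there exist a⁻ and a⁺ with −∞ ≤ a⁻ < a < a⁺ ≤ ∞ and a function y : (a⁻, a⁺) → ℝ such that y(a) = b, y is differentiable with y′(x) = F(x, y(x)) for all x ∈ (a⁻, a⁺), and: if a⁺ < ∞ then y(x) tends to +∞ or to −∞ as x → (a⁺)⁻, and if a⁻ > −∞ then y(x) tends to +∞ or to −∞ as x → (a⁻)⁺. -/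
open Filter Topology

/-- Iterates of an Euler scheme with step `h`, run forwards on `k ≥ 0` and backwards on `k < 0`. -/
noncomputable def eulerIterate {E : Type*} [NormedAddCommGroup E] [NormedSpace ℝ E]
    (G : E → E) (z₀ : E) (h : ℝ) : ℤ → E
  | Int.ofNat k => (fun z => z + h • G z)^[k] z₀
  | Int.negSucc k => (fun z => z - h • G z)^[k + 1] z₀

section Peano

variable {E : Type*} [NormedAddCommGroup E] [NormedSpace ℝ E]

theorem eulerIterate_step (G : E → E) (z₀ : E) (h : ℝ) (k : ℤ) :
    ∃ j ∈ Set.Icc k (k + 1),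
      eulerIterate G z₀ h (k + 1) - eulerIterate G z₀ h k = h • G (eulerIterate G z₀ h j) := by
  rcases k with k | k
  · refine ⟨Int.ofNat k, by simp, ?_⟩
    change (fun z => z + h • G z)^[k + 1] z₀ - (fun z => z + h • G z)^[k] z₀ = _
    rw [Function.iterate_succ_apply']
    simp [eulerIterate]
  · refine ⟨Int.negSucc k + 1, by simp, ?_⟩
    have key : eulerIterate G z₀ h (Int.negSucc k + 1) = (fun z => z - h • G z)^[k] z₀ := by
      cases k <;> rfl
    rw [key]
    simp only [eulerIterate]
    rw [Function.iterate_succ_apply']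
    simp

/-- If the field stays `ε`-close to `v` along the scheme, its increments are `ε`-close to those
of constant velocity `v`. -/
theorem norm_eulerIterate_sub_le {G : E → E} {z₀ : E} {h ε : ℝ} (hh : 0 ≤ h) {v : E} {k m : ℤ}
    (hkm : k ≤ m) (hv : ∀ j ∈ Set.Icc k m, ‖G (eulerIterate G z₀ h j) - v‖ ≤ ε) :
    ‖eulerIterate G z₀ h m - eulerIterate G z₀ h k - ((m - k : ℝ) * h) • v‖
      ≤ ε * ((m - k) * h) := by
  induction m, hkm using Int.leInduction with
  | base => simp
  | succ m hkm ih =>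
    have ih' := ih fun j hj => hv j ⟨hj.1, hj.2.trans (by omega)⟩
    obtain ⟨j, hj, hstep⟩ := eulerIterate_step G z₀ h m
    have hj' := hv j ⟨hkm.trans hj.1, hj.2⟩
    have hsplit : eulerIterate G z₀ h (m + 1) - eulerIterate G z₀ h k
        - ((((m + 1 : ℤ) : ℝ) - k) * h) • v
        = (eulerIterate G z₀ h m - eulerIterate G z₀ h k - ((m - k : ℝ) * h) • v)
          + h • (G (eulerIterate G z₀ h j) - v) := by
      rw [smul_sub, ← hstep]
      push_cast
      module
    rw [hsplit]
    refine (norm_add_le _ _).trans ?_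
    rw [norm_smul, Real.norm_of_nonneg hh]
    push_cast
    nlinarith [mul_le_mul_of_nonneg_left hj' hh]

theorem norm_eulerIterate_sub_le_of_uIcc {G : E → E} {z₀ : E} {h ε : ℝ} (hh : 0 ≤ h) {v : E}
    {k m : ℤ} (hv : ∀ j ∈ Set.uIcc k m, ‖G (eulerIterate G z₀ h j) - v‖ ≤ ε) :
    ‖eulerIterate G z₀ h m - eulerIterate G z₀ h k - ((m - k : ℝ) * h) • v‖
      ≤ ε * |(m - k) * h| := by
  rcases le_total k m with hkm | hkm
  · rw [Set.uIcc_of_le hkm] at hv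
    have hnn : 0 ≤ (m - k : ℝ) * h := mul_nonneg (sub_nonneg.2 (by exact_mod_cast hkm)) hh
    rw [abs_of_nonneg hnn]
    exact norm_eulerIterate_sub_le hh hkm hv
  · rw [Set.uIcc_of_ge hkm] at hv
    have hnn : 0 ≤ (k - m : ℝ) * h := mul_nonneg (sub_nonneg.2 (by exact_mod_cast hkm)) hh
    have hneg : (m - k : ℝ) * h = -((k - m) * h) := by ring
    rw [hneg, abs_neg, abs_of_nonneg hnn, ← norm_neg]
    refine (congrArg norm ?_).trans_le (norm_eulerIterate_sub_le hh hkm hv)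
    module

theorem norm_eulerIterate_sub_le_abs {G : E → E} (hG : ∀ z, ‖G z‖ ≤ 1) {z₀ : E} {h : ℝ}
    (hh : 0 ≤ h) (k m : ℤ) :
    ‖eulerIterate G z₀ h m - eulerIterate G z₀ h k‖ ≤ |(m - k) * h| := by
  simpa using norm_eulerIterate_sub_le_of_uIcc (G := G) (z₀ := z₀) (v := 0) (ε := 1) (k := k)
    (m := m) hh fun j _ => by simpa using hG _

theorem tendsto_intFloor_mul_mul_inv (t : ℝ) :
    Tendsto (fun n : ℕ => (⌊t * n⌋ : ℝ) * (n : ℝ)⁻¹) atTop (𝓝 t) := by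
  have hinv : Tendsto (fun n : ℕ => (n : ℝ)⁻¹) atTop (𝓝 0) := tendsto_inv_atTop_nhds_zero_nat
  refine tendsto_of_tendsto_of_tendsto_of_le_of_le' (g := fun n : ℕ => t - (n : ℝ)⁻¹)
    (h := fun _ => t) (by simpa using hinv.const_sub t) tendsto_const_nhds ?_ ?_
  all_goals
    filter_upwards [eventually_gt_atTop 0] with n hn
    have hn' : (0 : ℝ) < n := by exact_mod_cast hn
    rw [← div_eq_mul_inv]
  · rw [le_div_iff₀ hn', sub_mul, inv_mul_cancel₀ hn'.ne']
    exact (Int.sub_one_lt_floor _).le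
  · rw [div_le_iff₀ hn']
    exact Int.floor_le _

/-- **Peano's theorem**: a bounded continuous autonomous field has a solution on all of `ℝ`. -/
theorem exists_forall_hasDerivAt_of_continuous_of_norm_le_one [ProperSpace E] {G : E → E}
    (hGc : Continuous G) (hG : ∀ z, ‖G z‖ ≤ 1) (z₀ : E) :
    ∃ z : ℝ → E, z 0 = z₀ ∧ ∀ t, HasDerivAt z (G (z t)) t := by
  set U : Filter ℕ := (hyperfilter ℕ : Filter ℕ)
  have hU : U ≤ atTop := Nat.hyperfilter_le_atTop
  set w : ℕ → ℤ → E := fun n => eulerIterate G z₀ (n : ℝ)⁻¹ with hw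
  have hw0 (n : ℕ) : w n 0 = z₀ := rfl
  have hfl (t : ℝ) : Tendsto (fun n : ℕ => (⌊t * n⌋ : ℝ) * (n : ℝ)⁻¹) U (𝓝 t) :=
    (tendsto_intFloor_mul_mul_inv t).mono_left hU
  have hfl_sub (s t : ℝ) :
      Tendsto (fun n : ℕ => ((⌊s * n⌋ : ℝ) - ⌊t * n⌋) * (n : ℝ)⁻¹) U (𝓝 (s - t)) := by
    simpa only [sub_mul] using (hfl s).sub (hfl t)
  have hlim (t : ℝ) : ∃ x, Tendsto (fun n : ℕ => w n ⌊t * n⌋) U (𝓝 x) := by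
    have hmem : ∀ᶠ n in U, w n ⌊t * n⌋ ∈ Metric.closedBall z₀ (|t| + 1) := by
      filter_upwards [(hfl t).abs.eventually_le_const (lt_add_one |t|)] with n hn
      rw [mem_closedBall_iff_norm, ← hw0 n]
      refine (norm_eulerIterate_sub_le_abs hG (by positivity) _ _).trans ?_
      simpa using hn
    obtain ⟨x, -, hx⟩ := (isCompact_closedBall z₀ (|t| + 1)).ultrafilter_le_nhds'
      ((hyperfilter ℕ).map fun n : ℕ => w n ⌊t * n⌋) hmem
    exact ⟨x, hx⟩
  choose z hz using hlim
  refine ⟨z, ?_, fun t => ?_⟩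
  · refine tendsto_nhds_unique (hz 0) ?_
    simp [hw0]
  rw [hasDerivAt_iff_isLittleO, Asymptotics.isLittleO_iff]
  intro ε hε
  obtain ⟨δ, hδ, hGδ⟩ := Metric.continuousAt_iff.1 (hGc.continuousAt (x := z t)) ε hε
  filter_upwards [Metric.ball_mem_nhds t (half_pos hδ)] with s hs
  rw [Metric.mem_ball, Real.dist_eq] at hs
  have hleft := ((hz s).sub (hz t)).sub ((hfl_sub s t).smul_const (G (z t)))
  have hright := (hfl_sub s t).abs.const_mul ε
  refine le_of_tendsto_of_tendsto hleft.norm hright ?_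
  filter_upwards [(hfl_sub s t).abs.eventually_lt_const hs,
    (hz t).eventually (Metric.ball_mem_nhds _ (half_pos hδ))] with n hn hnt
  refine norm_eulerIterate_sub_le_of_uIcc (by positivity) fun j hj => ?_
  rw [← dist_eq_norm]
  refine (hGδ ?_).le
  have hjt : dist (w n j) (w n ⌊t * n⌋) < δ / 2 := by
    rw [dist_eq_norm]
    refine ((norm_eulerIterate_sub_le_abs hG (by positivity) _ _).trans ?_).trans_lt hn
    rw [abs_mul, abs_mul]
    gcongr ?_ * _
    exact_mod_cast Set.abs_sub_left_of_mem_uIcc hj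
  calc dist (w n j) (z t) ≤ dist (w n j) (w n ⌊t * n⌋) + dist (w n ⌊t * n⌋) (z t) :=
        dist_triangle _ _ _
    _ < δ := by linarith [Metric.mem_ball.1 hnt]

end Peano

section EndpointBehaviour

/-- If the first component of a planar trajectory of a nonvanishing field converges and the second
one has speed at most `1`, then the second component is unbounded in the limit. -/
theorem tendsto_abs_atTop_of_tendsto_nhds {G : ℝ × ℝ → ℝ} (hG : Continuous G) (hG0 : ∀ p, G p ≠ 0)
    {x y : ℝ → ℝ} (hx : ∀ s, HasDerivAt x (G (x s, y s)) s) (hy : ∀ s t, |y s - y t| ≤ |s - t|)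
    {r : ℝ} (hr : Tendsto x atTop (𝓝 r)) : Tendsto (fun s => |y s|) atTop atTop := by
  by_contra hnot
  rw [tendsto_atTop] at hnot
  push Not at hnot
  obtain ⟨M, hM⟩ := hnot
  obtain ⟨q, -, hq⟩ := (isCompact_Icc (a := -M) (b := M)).exists_mapClusterPt_of_frequently
    (hM.mono fun s hs => abs_le.1 hs.le)
  have hc : 0 < |G (r, q)| / 2 := half_pos (abs_pos.2 (hG0 _))
  have hnear : ∀ᶠ p in 𝓝 (r, q), |G (r, q)| / 2 < |G p| :=
    hG.abs.continuousAt.eventually (lt_mem_nhds (half_lt_self (abs_pos.2 (hG0 _))))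
  set c := |G (r, q)| / 2
  obtain ⟨δ, hδ, hball⟩ := Metric.eventually_nhds_iff.1 hnear
  have hη : 0 < min δ (c * δ / 4) := by positivity
  obtain ⟨N, hN⟩ := eventually_atTop.1 (hr.eventually (Metric.ball_mem_nhds r hη))
  obtain ⟨s, hsq, hsN⟩ := ((mapClusterPt_iff_frequently.1 hq _
    (Metric.ball_mem_nhds q (half_pos hδ))).and_eventually (eventually_ge_atTop N)).exists
  obtain ⟨ξ, hξ, hslope⟩ := exists_hasDerivAt_eq_slope x (fun s => G (x s, y s))
    (show s < s + δ / 2 by linarith) (fun u _ => (hx u).continuousAt.continuousWithinAt)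
    fun u _ => hx u
  have hξN := lt_min_iff.1 (Metric.mem_ball.1 (hN ξ (hsN.trans hξ.1.le)))
  have h₁ := (lt_min_iff.1 (Metric.mem_ball.1 (hN s hsN))).2
  have h₂ := (lt_min_iff.1 (Metric.mem_ball.1 (hN (s + δ / 2) (by linarith)))).2
  have hyξ : dist (y ξ) q < δ := by
    have hys : dist (y ξ) (y s) ≤ ξ - s := by
      rw [Real.dist_eq]
      exact (hy ξ s).trans_eq (abs_of_pos (sub_pos.2 hξ.1))
    linarith [dist_triangle (y ξ) (y s) q, Metric.mem_ball.1 hsq, hξ.2]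
  have hlarge : c < |G (x ξ, y ξ)| := hball (by simpa [Prod.dist_eq] using ⟨hξN.1, hyξ⟩)
  have hincr : |G (x ξ, y ξ)| * (δ / 2) < c * δ / 2 := by
    have hmul : |G (x ξ, y ξ)| * (δ / 2) = dist (x (s + δ / 2)) (x s) := by
      rw [show G (x ξ, y ξ) = _ from hslope, Real.dist_eq, add_sub_cancel_left, abs_div,
        abs_of_pos (half_pos hδ), div_mul_cancel₀ _ (half_pos hδ).ne']
    rw [hmul]
    linarith [dist_triangle_right (x (s + δ / 2)) (x s) r]
  nlinarith

theorem tendsto_atTop_or_atBot_of_tendsto_abs_s1 {y : ℝ → ℝ} (hy : Continuous y)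
    (h : Tendsto (fun s => |y s|) atTop atTop) :
    Tendsto y atTop atTop ∨ Tendsto y atTop atBot := by
  obtain ⟨N, hN⟩ := eventually_atTop.1 (h.eventually_gt_atTop 0)
  have hsign : (∀ s ≥ N, 0 < y s) ∨ ∀ s ≥ N, y s < 0 := by
    by_contra! hcon
    obtain ⟨⟨s, hs, hs0⟩, t, ht, ht0⟩ := hcon
    obtain ⟨u, hu, hu0⟩ := isPreconnected_Ici.intermediate_value (Set.mem_Ici.2 hs)
      (Set.mem_Ici.2 ht) hy.continuousOn ⟨hs0, ht0⟩
    exact (abs_pos.1 (hN u hu)) hu0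
  refine hsign.imp (fun hpos => ?_) fun hneg => ?_
  · refine h.congr' ?_
    filter_upwards [eventually_ge_atTop N] with s hs using abs_of_pos (hpos s hs)
  · rw [← tendsto_neg_atTop_iff]
    refine h.congr' ?_
    filter_upwards [eventually_ge_atTop N] with s hs using abs_of_neg (hneg s hs)

end EndpointBehaviour

/-- After a change of time with speed `g`, the graph of a solution of `y' = F (x, y)` is swept out
by a trajectory defined for all times. -/
theorem exists_global_reparametrized_solution {F : ℝ × ℝ → ℝ} (hF : Continuous F) (a b : ℝ) :
    ∃ (g : ℝ × ℝ → ℝ) (x y : ℝ → ℝ), Continuous g ∧ (∀ p, 0 < g p) ∧ x 0 = a ∧ y 0 = b ∧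
      (∀ s, HasDerivAt x (g (x s, y s)) s) ∧
      (∀ s, HasDerivAt y (g (x s, y s) * F (x s, y s)) s) ∧
      ∀ s t, |y s - y t| ≤ |s - t| := by
  have hpos (p : ℝ × ℝ) : 0 < 1 + |F p| := by positivity
  have hg : Continuous fun p => (1 + |F p|)⁻¹ :=
    (continuous_const.add hF.abs).inv₀ fun p => (hpos p).ne'
  have hbound (p : ℝ × ℝ) : |(1 + |F p|)⁻¹ * F p| ≤ 1 := by
    rw [abs_mul, abs_of_pos (inv_pos.2 (hpos p)), inv_mul_le_one₀ (hpos p)]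
    linarith
  obtain ⟨z, hz0, hz⟩ := exists_forall_hasDerivAt_of_continuous_of_norm_le_one
    (G := fun p : ℝ × ℝ => ((1 + |F p|)⁻¹, (1 + |F p|)⁻¹ * F p)) (hg.prodMk (hg.mul hF))
    (fun p => by
      refine max_le ?_ (hbound p)
      rw [Real.norm_of_nonneg (inv_nonneg.2 (hpos p).le)]
      exact inv_le_one_of_one_le₀ (by simp)) (a, b)
  have hy (s : ℝ) : HasDerivAt (fun s => (z s).2) ((1 + |F (z s)|)⁻¹ * F (z s)) s :=
    (ContinuousLinearMap.snd ℝ ℝ ℝ).hasFDerivAt.comp_hasDerivAt s (hz s)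
  refine ⟨fun p => (1 + |F p|)⁻¹, fun s => (z s).1, fun s => (z s).2, hg,
    fun p => inv_pos.2 (hpos p), by simp [hz0], by simp [hz0],
    fun s => (ContinuousLinearMap.fst ℝ ℝ ℝ).hasFDerivAt.comp_hasDerivAt s (hz s), hy, fun s t => ?_⟩
  simpa using convex_univ.norm_image_sub_le_of_norm_hasDerivWithin_le
    (fun u _ => (hy u).hasDerivWithinAt) (fun u _ => hbound (z u)) (Set.mem_univ t)
    (Set.mem_univ s)

/-- **Two-sided global Peano existence theorem** (Remark 4.5).
Let `F : ℝ² → ℝ` be continuous and `(a, b) ∈ ℝ²`. Then there exist `a⁻, a⁺` with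
`-∞ ≤ a⁻ < a < a⁺ ≤ ∞` and `y : (a⁻, a⁺) → ℝ` with `y a = b`, `y' x = F (x, y x)`
on `(a⁻, a⁺)`, and blow-up (`→ +∞` or `→ -∞`) at every finite endpoint. -/
theorem global_peano_two_sided (F : ℝ × ℝ → ℝ) (hF : Continuous F) (a b : ℝ) :
    ∃ (am ap : EReal) (y : ℝ → ℝ),
      am < (a : EReal) ∧ (a : EReal) < ap ∧
      y a = b ∧
      (∀ x : ℝ, am < (x : EReal) → (x : EReal) < ap → HasDerivAt y (F (x, y x)) x) ∧
      (∀ r : ℝ, ap = (r : EReal) →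
        Filter.Tendsto y (nhdsWithin r (Set.Iio r)) Filter.atTop ∨
        Filter.Tendsto y (nhdsWithin r (Set.Iio r)) Filter.atBot) ∧
      (∀ r : ℝ, am = (r : EReal) →
        Filter.Tendsto y (nhdsWithin r (Set.Ioi r)) Filter.atTop ∨
        Filter.Tendsto y (nhdsWithin r (Set.Ioi r)) Filter.atBot) := by
  obtain ⟨g, x, y, hg, hgpos, hx0, hy0, hx, hy, hylip⟩ :=
    exists_global_reparametrized_solution hF a b
  have hxmono : StrictMono x := strictMono_of_hasDerivAt_pos hx fun s => hgpos _
  have hxcont : Continuous x := continuous_iff_continuousAt.2 fun s => (hx s).continuousAt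
  have hycont : Continuous y := continuous_iff_continuousAt.2 fun s => (hy s).continuousAt
  have hxemb := hxmono.isEmbedding_of_ordConnected (isPreconnected_range hxcont).ordConnected
  have hxE : Monotone fun s => (x s : EReal) := fun s t hst =>
    EReal.coe_le_coe_iff.2 (hxmono.monotone hst)
  set σ := Function.invFun x
  have hσx (s : ℝ) : σ (x s) = s := Function.leftInverse_invFun hxmono.injective s
  set am : EReal := ⨅ s, (x s : EReal)
  set ap : EReal := ⨆ s, (x s : EReal)
  have hxσ (u : ℝ) (h₁ : am < u) (h₂ : (u : EReal) < ap) : x (σ u) = u := by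
    obtain ⟨s, hs⟩ := iInf_lt_iff.1 h₁
    obtain ⟨t, ht⟩ := lt_iSup_iff.1 h₂
    exact Function.invFun_eq (mem_range_of_exists_le_of_exists_ge hxcont
      ⟨s, (EReal.coe_lt_coe_iff.1 hs).le⟩ ⟨t, (EReal.coe_lt_coe_iff.1 ht).le⟩)
  have hlt_ap (s : ℝ) : (x s : EReal) < ap :=
    (EReal.coe_lt_coe_iff.2 (hxmono (lt_add_one s))).trans_le
      (le_iSup (fun s => (x s : EReal)) (s + 1))
  have ham_lt (s : ℝ) : am < (x s : EReal) :=
    (iInf_le (fun s => (x s : EReal)) (s - 1)).trans_lt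
      (EReal.coe_lt_coe_iff.2 (hxmono (sub_one_lt s)))
  refine ⟨am, ap, y ∘ σ, hx0 ▸ ham_lt 0, hx0 ▸ hlt_ap 0, ?_, fun u h₁ h₂ => ?_, fun r hr => ?_,
    fun r hr => ?_⟩
  · rw [Function.comp_apply, ← hx0, hσx, hy0]
  · have hev : ∀ᶠ v in 𝓝 u, x (σ v) = v := by
      filter_upwards [continuous_coe_real_ereal.continuousAt.eventually (Ioo_mem_nhds h₁ h₂)]
        with v hv using hxσ v hv.1 hv.2
    have hσcont : ContinuousAt σ u :=
      hxemb.isInducing.continuousAt_iff.2 (continuousAt_id.congr_of_eventuallyEq hev)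
    have hσ' := HasDerivAt.of_local_left_inverse hσcont (hx (σ u)) (hgpos _).ne' hev
    refine ((hy (σ u)).comp u hσ').congr_deriv ?_
    rw [hxσ u h₁ h₂, Function.comp_apply, mul_right_comm, mul_inv_cancel₀ (hgpos _).ne', one_mul]
  · have hxr : Tendsto x atTop (𝓝 r) :=
      EReal.tendsto_coe.1 (hr ▸ tendsto_atTop_iSup hxE)
    have hσ : Tendsto σ (𝓝[<] r) atTop := by
      refine tendsto_atTop.2 fun N => ?_
      have hN : x N < r := EReal.coe_lt_coe_iff.1 (hr ▸ hlt_ap N)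
      filter_upwards [Ioo_mem_nhdsLT hN] with u hu
      refine hxmono.le_iff_le.1 ?_
      rw [hxσ u ((ham_lt N).trans (EReal.coe_lt_coe_iff.2 hu.1))
        (hr ▸ EReal.coe_lt_coe_iff.2 hu.2)]
      exact hu.1.le
    exact (tendsto_atTop_or_atBot_of_tendsto_abs_s1 hycont
      (tendsto_abs_atTop_of_tendsto_nhds hg (fun p => (hgpos p).ne') hx hylip hxr)).imp
      (·.comp hσ) (·.comp hσ)
  · have hxr : Tendsto (fun s => x (-s)) atTop (𝓝 r) :=
      (EReal.tendsto_coe.1 (hr ▸ tendsto_atBot_iInf hxE)).comp tendsto_neg_atTop_atBot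
    have hσ : Tendsto (fun u => -σ u) (𝓝[>] r) atTop := by
      refine tendsto_atTop.2 fun N => ?_
      have hN : r < x (-N) := EReal.coe_lt_coe_iff.1 (hr ▸ ham_lt (-N))
      filter_upwards [Ioo_mem_nhdsGT hN] with u hu
      refine le_neg_of_le_neg (hxmono.le_iff_le.1 ?_)
      rw [hxσ u (hr ▸ EReal.coe_lt_coe_iff.2 hu.1)
        ((EReal.coe_lt_coe_iff.2 hu.2).trans (hlt_ap (-N)))]
      exact hu.2.le
    have hcomp : y ∘ σ = (fun s => y (-s)) ∘ fun u => -σ u := by ext u; simp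
    rw [hcomp]
    refine (tendsto_atTop_or_atBot_of_tendsto_abs_s1 (hycont.comp continuous_neg)
      (tendsto_abs_atTop_of_tendsto_nhds hg.neg (fun p => neg_ne_zero.2 (hgpos p).ne')
        (fun s => ?_) (fun s t => ?_) hxr)).imp (·.comp hσ) (·.comp hσ)
    · exact ((hx (-s)).comp s (hasDerivAt_neg s)).congr_deriv (mul_neg_one _)
    · simpa [abs_sub_comm, neg_add_eq_sub] using hylip (-s) (-t)
end

section
/- Let D ⊆ ℝ² be open, F : D → ℝ continuous, and (a, b) ∈ D. Then there exist a⁻ and a⁺ with −∞ ≤ a⁻ < a < a⁺ ≤ ∞ and a differentiable function y : (a⁻, a⁺) → ℝ such that y(a) = b, (x, y(x)) ∈ D and y′(x) = F(x, y(x)) for all x ∈ (a⁻, a⁺), and the solution tends to the boundary of D in the following sense: for every compact K ⊆ D there is c < a⁺ such that (x, y(x)) ∉ K for all c < x < a⁺, and there is c′ > a⁻ such that (x, y(x)) ∉ K for all a⁻ < x < c′. -/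
open Filter Topology Set

/-- Increment estimate for an Euler sequence of step `h` along which the field is `ε`-close to `c`. -/
theorem norm_eulerSeq_sub_le {E : Type*} [NormedAddCommGroup E] [NormedSpace ℝ E] {G : E → E}
    {h : ℝ} (hh : 0 ≤ h) {z : ℕ → E} (hz : ∀ k, z (k + 1) = z k + h • G (z k)) {c : E} {ε : ℝ}
    {i j : ℕ} (hij : i ≤ j) (hG : ∀ k, i ≤ k → k < j → ‖G (z k) - c‖ ≤ ε) :
    ‖z j - z i - (j * h - i * h) • c‖ ≤ (j * h - i * h) * ε := by
  induction j, hij using Nat.le_induction with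
  | base => simp
  | succ j hij ih =>
    have h1 := ih fun k hk hkj => hG k hk (hkj.trans j.lt_succ_self)
    have h2 : ‖h • (G (z j) - c)‖ ≤ h * ε := by
      rw [norm_smul, Real.norm_of_nonneg hh]
      exact mul_le_mul_of_nonneg_left (hG j hij j.lt_succ_self) hh
    have h3 : z (j + 1) - z i - (((j + 1 : ℕ) : ℝ) * h - i * h) • c =
        (z j - z i - (j * h - i * h) • c) + h • (G (z j) - c) := by
      rw [hz]; push_cast; module
    rw [h3]
    refine (norm_add_le _ _).trans ((add_le_add h1 h2).trans_eq ?_)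
    push_cast; ring

theorem tendsto_floor_mul_mul_inv {t : ℝ} (ht : 0 ≤ t) :
    Tendsto (fun n : ℕ => (⌊t * n⌋₊ : ℝ) * (n : ℝ)⁻¹) atTop (𝓝 t) :=
  (tendsto_nat_floor_mul_div_atTop ht).comp (tendsto_natCast_atTop_atTop (R := ℝ))

/-- A pointwise limit, along an ultrafilter, of Euler approximations for a bounded field, together
with the increment estimate it inherits. -/
theorem exists_limit_eulerSeq {E : Type*} [NormedAddCommGroup E]
    [NormedSpace ℝ E] [ProperSpace E] {G : E → E} {M : ℝ}
    (hM : ∀ x, ‖G x‖ ≤ M) (x₀ : E) :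
    ∃ p : ℝ → E, p 0 = x₀ ∧ ∀ (s t : ℝ) (x c : E) (r ε : ℝ), 0 ≤ s → s ≤ t →
      (∀ q ∈ Metric.ball x r, ‖G q - c‖ ≤ ε) → (t - s) * M + ‖p s - x‖ < r →
      ‖p t - p s - (t - s) • c‖ ≤ (t - s) * ε := by
  have hM0 : 0 ≤ M := (norm_nonneg _).trans (hM x₀)
  obtain ⟨z, hz0, hz⟩ : ∃ z : ℕ → ℕ → E, (∀ n, z n 0 = x₀) ∧
      ∀ n k, z n (k + 1) = z n k + (n : ℝ)⁻¹ • G (z n k) :=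
    ⟨fun n k => (fun x => x + (n : ℝ)⁻¹ • G x)^[k] x₀, fun _ => rfl,
      fun _ k => Function.iterate_succ_apply' _ k x₀⟩
  have hlip : ∀ n {i j : ℕ}, i ≤ j →
      ‖z n j - z n i‖ ≤ (j * (n : ℝ)⁻¹ - i * (n : ℝ)⁻¹) * M := fun n i j hij => by
    simpa using norm_eulerSeq_sub_le (c := 0) (by positivity) (hz n) hij
      (fun k _ _ => by simpa using hM (z n k))
  obtain ⟨U, hU⟩ : ∃ U : Ultrafilter ℕ, (U : Filter ℕ) ≤ atTop :=
    ⟨hyperfilter ℕ, Nat.hyperfilter_le_atTop⟩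
  have hlim : ∀ t : ℝ, ∃ q, Tendsto (fun n => z n ⌊t * n⌋₊) U (𝓝 q) := by
    intro t
    have hb : ∀ n, z n ⌊t * n⌋₊ ∈ Metric.closedBall x₀ (|t| * M) := by
      intro n
      rw [mem_closedBall_iff_norm, ← hz0 n]
      refine (hlip n (Nat.zero_le ⌊t * n⌋₊)).trans ?_
      gcongr
      rcases Nat.eq_zero_or_pos n with rfl | hn
      · simp
      have hn' : (0 : ℝ) < n := by exact_mod_cast hn
      have : (⌊t * n⌋₊ : ℝ) ≤ |t| * n :=
        (Nat.cast_le.2 (Nat.floor_mono (by gcongr; exact le_abs_self t))).trans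
          (Nat.floor_le (by positivity))
      simpa [← div_eq_mul_inv] using (div_le_iff₀ hn').2 this
    obtain ⟨q, -, hq⟩ := (isCompact_closedBall x₀ (|t| * M)).ultrafilter_le_nhds
      (U.map fun n => z n ⌊t * n⌋₊) (by
        rw [le_principal_iff]; exact Filter.mem_map.2 (univ_mem' hb))
    exact ⟨q, hq⟩
  choose p hp using hlim
  have hfloor : ∀ t : ℝ, 0 ≤ t → Tendsto (fun n : ℕ => (⌊t * n⌋₊ : ℝ) * (n : ℝ)⁻¹) U (𝓝 t) :=
    fun t ht => (tendsto_floor_mul_mul_inv ht).mono_left hU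
  have hidx : ∀ {s t : ℝ}, s ≤ t → ∀ n : ℕ, ⌊s * n⌋₊ ≤ ⌊t * n⌋₊ := fun hst n =>
    Nat.floor_mono (by gcongr)
  refine ⟨p, tendsto_nhds_unique (hp 0) (by simp [hz0]), fun s t x c r ε hs hst hGr hsmall => ?_⟩
  have hm := (hfloor t (hs.trans hst)).sub (hfloor s hs)
  refine le_of_tendsto_of_tendsto (((hp t).sub (hp s)).sub (hm.smul_const c)).norm
    (hm.mul_const ε) ?_
  have hev : ∀ᶠ n : ℕ in (U : Filter ℕ), (⌊t * n⌋₊ * (n : ℝ)⁻¹ - ⌊s * n⌋₊ * (n : ℝ)⁻¹) * M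
      + ‖z n ⌊s * n⌋₊ - x‖ < r :=
    ((hm.mul_const M).add ((hp s).sub_const x).norm).eventually_lt_const hsmall
  filter_upwards [hev] with n hn
  refine norm_eulerSeq_sub_le (by positivity) (hz n) (hidx hst n) fun k hk hkj => hGr _ ?_
  rw [mem_ball_iff_norm]
  have h1 : ‖z n k - x‖ ≤ ‖z n k - z n ⌊s * n⌋₊‖ + ‖z n ⌊s * n⌋₊ - x‖ :=
      norm_sub_le_norm_sub_add_norm_sub ..
  have h2 := hlip n hk
  have h3 : (k * (n : ℝ)⁻¹ - ⌊s * n⌋₊ * (n : ℝ)⁻¹) * M ≤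
      (⌊t * n⌋₊ * (n : ℝ)⁻¹ - ⌊s * n⌋₊ * (n : ℝ)⁻¹) * M := by gcongr
  linarith

theorem exists_forward_solution_of_continuous_of_bounded {E : Type*} [NormedAddCommGroup E]
    [NormedSpace ℝ E] [ProperSpace E] {G : E → E} (hG : Continuous G) {M : ℝ}
    (hM : ∀ x, ‖G x‖ ≤ M) (x₀ : E) :
    ∃ p : ℝ → E, p 0 = x₀ ∧ ∀ t, 0 ≤ t → HasDerivWithinAt p (G (p t)) (Ici 0) t := by
  obtain ⟨p, hp0, hp⟩ := exists_limit_eulerSeq hM x₀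
  have hM0 : 0 ≤ M := (norm_nonneg _).trans (hM x₀)
  have hplip : ∀ s t, 0 ≤ s → s ≤ t → ‖p t - p s‖ ≤ (t - s) * M := fun s t hs hst => by
    simpa using hp s t (p s) 0 ((t - s) * M + 1) M hs hst (fun q _ => by simpa using hM q) (by simp)
  refine ⟨p, hp0, fun x hx => ?_⟩
  rw [hasDerivWithinAt_iff_isLittleO, Asymptotics.isLittleO_iff]
  intro ε hε
  obtain ⟨r, hr, hGr⟩ := Metric.continuousAt_iff.1 (hG.continuousAt (x := p x)) ε hε
  have key : ∀ s t, 0 ≤ s → s ≤ t → (t - s) * M + ‖p s - p x‖ < r →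
      ‖p t - p s - (t - s) • G (p x)‖ ≤ (t - s) * ε := fun s t hs hst =>
    hp s t (p x) _ r ε hs hst fun q hq => (dist_eq_norm (G q) _).symm.trans_le (hGr hq).le
  have hδ : 0 < r / (2 * M + 1) := by positivity
  filter_upwards [inter_mem_nhdsWithin (Ici 0) (Metric.ball_mem_nhds x hδ)] with t ⟨ht, htx⟩
  rw [Metric.mem_ball, Real.dist_eq, lt_div_iff₀ (by positivity)] at htx
  rcases le_total x t with hxt | hxt
  · rw [abs_of_nonneg (sub_nonneg.2 hxt)] at htx
    rw [Real.norm_of_nonneg (sub_nonneg.2 hxt), mul_comm]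
    refine key x t hx hxt ?_
    rw [sub_self, norm_zero]
    nlinarith [mul_nonneg (sub_nonneg.2 hxt) hM0]
  · rw [abs_of_nonpos (sub_nonpos.2 hxt)] at htx
    have h0 := hplip t x ht hxt
    rw [norm_sub_rev] at h0
    have h1 := key t x ht hxt (by nlinarith [mul_nonneg (sub_nonneg.2 hxt) hM0])
    rw [Real.norm_of_nonpos (sub_nonpos.2 hxt), mul_comm, neg_sub]
    have h2 : p t - p x - (t - x) • G (p x) = -(p x - p t - (x - t) • G (p x)) := by module
    rwa [h2, norm_neg]

/-- **Peano existence theorem** for a bounded continuous autonomous field, with a solution on `ℝ`. -/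
theorem exists_solution_of_continuous_of_bounded {E : Type*} [NormedAddCommGroup E]
    [NormedSpace ℝ E] [ProperSpace E] {G : E → E} (hG : Continuous G) {M : ℝ}
    (hM : ∀ x, ‖G x‖ ≤ M) (x₀ : E) :
    ∃ p : ℝ → E, p 0 = x₀ ∧ ∀ t, HasDerivAt p (G (p t)) t := by
  obtain ⟨f, hf0, hf⟩ := exists_forward_solution_of_continuous_of_bounded hG hM x₀
  obtain ⟨g, hg0, hg⟩ := exists_forward_solution_of_continuous_of_bounded hG.neg
    (fun x => (norm_neg (G x)).trans_le (hM x)) x₀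
  let p : ℝ → E := fun t => if 0 ≤ t then f t else g (-t)
  have hpf : EqOn p f (Ici 0) := fun t ht => if_pos ht
  have hpg : EqOn p (fun t => g (-t)) (Iic 0) := fun t ht => by
    rcases (show t ≤ 0 from ht).eq_or_lt with rfl | h
    · simp [p, hf0, hg0]
    · exact if_neg h.not_ge
  have hr : ∀ t, 0 ≤ t → HasDerivWithinAt p (G (p t)) (Ici 0) t := fun t ht => by
    rw [hpf ht]; exact (hf t ht).congr hpf (hpf ht)
  have hl : ∀ t, t ≤ 0 → HasDerivWithinAt p (G (p t)) (Iic 0) t := fun t ht => by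
    have h := (hg (-t) (neg_nonneg.2 ht)).scomp t (hasDerivAt_neg t).hasDerivWithinAt
      (s := Iic 0) (t' := Ici 0) (fun u hu => mem_Ici.2 (neg_nonneg.2 hu))
    rw [neg_smul, one_smul, Pi.neg_apply, neg_neg] at h
    rw [hpg ht]; exact h.congr hpg (hpg ht)
  refine ⟨p, (hpf self_mem_Ici).trans hf0, fun t => ?_⟩
  rcases lt_trichotomy t 0 with ht | rfl | ht
  · exact (hl t ht.le).hasDerivAt (Iic_mem_nhds ht)
  · simpa using (hl 0 le_rfl).union (hr 0 le_rfl)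
  · exact (hr t ht.le).hasDerivAt (Ici_mem_nhds ht)

theorem IsOpen.exists_continuous_pos_le_dist {X : Type*} [PseudoMetricSpace X] {D : Set X}
    (hD : IsOpen D) :
    ∃ d : X → ℝ, Continuous d ∧ (∀ x, 0 ≤ d x) ∧ (∀ x ∈ D, 0 < d x) ∧
      ∀ x, ∀ y ∉ D, d x ≤ dist x y := by
  rcases Dᶜ.eq_empty_or_nonempty with h | h
  · rw [compl_empty_iff] at h
    exact ⟨fun _ => 1, continuous_const, fun _ => zero_le_one, fun _ _ => one_pos,
      fun _ y hy => (hy (h ▸ mem_univ y)).elim⟩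
  · refine ⟨fun x => Metric.infDist x Dᶜ, Metric.continuous_infDist_pt _,
      fun _ => Metric.infDist_nonneg, fun x hx => ?_, fun x y hy => Metric.infDist_le_dist_of_mem hy⟩
    exact (hD.isClosed_compl.notMem_iff_infDist_pos h).1 (not_not.2 hx)

/-- A continuous field on an open set `D` can be rescaled by a positive function on `D` so that it
extends continuously by zero, and its norm is at most the distance to any point outside `D`. -/
theorem ContinuousOn.exists_pos_smul_continuous {E E' : Type*} [SeminormedAddCommGroup E]
    [NormedAddCommGroup E'] [NormedSpace ℝ E'] {D : Set E} (hD : IsOpen D) {V : E → E'}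
    (hV : ContinuousOn V D) :
    ∃ φ : E → ℝ, (∀ x ∈ D, 0 < φ x) ∧ (Continuous fun x => φ x • V x) ∧
      (∀ x, ‖φ x • V x‖ ≤ 1) ∧ ∀ x, ∀ y ∉ D, ‖φ x • V x‖ ≤ ‖x - y‖ := by
  obtain ⟨d, hd, hd0, hdpos, hdle⟩ := hD.exists_continuous_pos_le_dist
  have hden : ∀ x, 0 < 1 + ‖V x‖ := fun x => by positivity
  have hmin : ∀ x, 0 ≤ min 1 (d x) := fun x => le_min zero_le_one (hd0 x)
  have hle : ∀ x, ‖(min 1 (d x) / (1 + ‖V x‖)) • V x‖ ≤ min 1 (d x) := by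
    intro x
    rw [norm_smul, Real.norm_of_nonneg (div_nonneg (hmin x) (hden x).le), div_mul_eq_mul_div,
      div_le_iff₀ (hden x)]
    exact mul_le_mul_of_nonneg_left (by linarith) (hmin x)
  refine ⟨fun x => min 1 (d x) / (1 + ‖V x‖),
    fun x hx => div_pos (lt_min one_pos (hdpos x hx)) (hden x), ?_,
    fun x => (hle x).trans (min_le_left _ _), fun x y hy =>
      (hle x).trans ((min_le_right _ _).trans ((hdle x y hy).trans_eq (dist_eq_norm x y)))⟩
  rw [continuous_iff_continuousAt]
  intro x
  by_cases hx : x ∈ D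
  · have hVx : ContinuousAt V x := hV.continuousAt (hD.mem_nhds hx)
    exact ((continuousAt_const.min hd.continuousAt).div (continuousAt_const.add hVx.norm)
      (hden x).ne').smul hVx
  · have hdx : d x = 0 := le_antisymm (by simpa using hdle x x hx) (hd0 x)
    have h0 : (min 1 (d x) / (1 + ‖V x‖)) • V x = 0 := by simp [hdx]
    rw [ContinuousAt, h0]
    refine squeeze_zero_norm hle ?_
    have : Tendsto (fun x => min 1 (d x)) (𝓝 x) (𝓝 (min 1 (d x))) :=
      (continuous_const.min hd).continuousAt
    simpa [hdx] using this

theorem eq_of_norm_le_norm_sub_of_le {E : Type*} [NormedAddCommGroup E] [NormedSpace ℝ E]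
    {G : E → E} {y : E} (hG : ∀ x, ‖G x‖ ≤ ‖x - y‖) {p : ℝ → E}
    (hp : ∀ t, HasDerivAt p (G (p t)) t) {T t : ℝ} (hT : p T = y) (ht : T ≤ t) : p t = y := by
  refine sub_eq_zero.1 (eq_zero_of_abs_deriv_le_mul_abs_self_of_eq_zero_right
    (f := fun s => p s - y) (f' := fun s => G (p s)) (K := 1) (a := T) (b := t)
    (fun s _ => ((hp s).sub_const y).continuousAt.continuousWithinAt)
    (fun s _ => ((hp s).sub_const y).hasDerivWithinAt) (sub_eq_zero.2 hT)
    (fun s _ => by simpa using hG (p s)) t ⟨ht, le_rfl⟩)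

theorem hasDerivAt_comp_neg_of_autonomous {E : Type*} [NormedAddCommGroup E] [NormedSpace ℝ E]
    {G : E → E} {p : ℝ → E} (hp : ∀ t, HasDerivAt p (G (p t)) t) (t : ℝ) :
    HasDerivAt (fun s => p (-s)) ((-G) (p (-t))) t := by
  simpa [Function.comp_def] using (hp (-t)).scomp t (hasDerivAt_neg t)

/-- A solution cannot reach `y` in finite time if `G` vanishes at `y` at least linearly. -/
theorem eq_of_norm_le_norm_sub {E : Type*} [NormedAddCommGroup E] [NormedSpace ℝ E]
    {G : E → E} {y : E} (hG : ∀ x, ‖G x‖ ≤ ‖x - y‖) {p : ℝ → E}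
    (hp : ∀ t, HasDerivAt p (G (p t)) t) {T : ℝ} (hT : p T = y) (t : ℝ) : p t = y := by
  rcases le_total T t with ht | ht
  · exact eq_of_norm_le_norm_sub_of_le hG hp hT ht
  · simpa using eq_of_norm_le_norm_sub_of_le (G := -G) (fun x => by simpa using hG x)
      (p := fun s => p (-s)) (hasDerivAt_comp_neg_of_autonomous hp) (T := -T) (t := -t)
      (by simpa using hT) (neg_le_neg ht)

/-- A trajectory leaves forever any compact set on which a functional monotone along the trajectory
has positive speed. -/
theorem eventually_notMem_of_pos_on_compact {E : Type*} [NormedAddCommGroup E] [NormedSpace ℝ E]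
    {G : E → E} (hG : Continuous G) {M : ℝ} (hM : ∀ x, ‖G x‖ ≤ M) {p : ℝ → E}
    (hp : ∀ t, HasDerivAt p (G (p t)) t) (l : E →L[ℝ] ℝ) (hmono : Monotone fun t => l (p t))
    {K : Set E} (hK : IsCompact K) (hpos : ∀ k ∈ K, 0 < l (G k)) :
    ∀ᶠ t in atTop, p t ∉ K := by
  by_contra hcon
  obtain ⟨k, hkK, hk⟩ := hK.exists_mapClusterPt_of_frequently (f := p) (l := atTop)
    (by simpa [Filter.Frequently] using hcon)
  have hM0 : 0 ≤ M := (norm_nonneg _).trans (hM k)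
  have hlp : ∀ t, HasDerivAt (fun s => l (p s)) (l (G (p t))) t := fun t =>
    l.hasFDerivAt.comp_hasDerivAt t (hp t)
  have hle : ∀ t, l (p t) ≤ l k := by
    intro t
    by_contra! h
    have hU : {q | l q < l (p t)} ∈ 𝓝 k := (isOpen_lt l.continuous continuous_const).mem_nhds h
    obtain ⟨s, hs, hts⟩ := ((hk.frequently hU).and_eventually (eventually_ge_atTop t)).exists
    exact (hmono hts).not_gt hs
  obtain ⟨ε, hε, hεk⟩ := exists_between (hpos k hkK)
  obtain ⟨r, hr, hball⟩ := Metric.isOpen_iff.1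
    (isOpen_lt continuous_const (l.continuous.comp hG)) k hεk
  set τ := r / (2 * (M + 1)) with hτ
  have hτ0 : 0 < τ := by positivity
  have hV : {q | l k - ε * τ < l q} ∩ Metric.ball k (r / 2) ∈ 𝓝 k :=
    inter_mem ((isOpen_lt continuous_const l.continuous).mem_nhds
      (by show l k - ε * τ < l k; nlinarith [mul_pos hε hτ0])) (Metric.ball_mem_nhds k (half_pos hr))
  obtain ⟨t, htl, htb⟩ := (hk.frequently hV).exists
  have hmem : ∀ s ∈ Icc t (t + τ), p s ∈ Metric.ball k r := by
    intro s hs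
    have h1 : ‖p s - p t‖ ≤ M * ‖s - t‖ :=
      convex_univ.norm_image_sub_le_of_norm_hasDerivWithin_le
        (fun u _ => (hp u).hasDerivWithinAt) (fun u _ => hM (p u)) (mem_univ t) (mem_univ s)
    rw [Real.norm_of_nonneg (sub_nonneg.2 hs.1)] at h1
    have h2 : M * (s - t) ≤ M * τ := by gcongr; linarith [hs.2]
    have h3 : (M + 1) * τ = r / 2 := by rw [hτ]; field_simp
    rw [mem_ball_iff_norm] at htb ⊢
    have h4 : ‖p s - k‖ ≤ ‖p s - p t‖ + ‖p t - k‖ := norm_sub_le_norm_sub_add_norm_sub ..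
    linarith
  have hgrow : ε * (t + τ - t) ≤ l (p (t + τ)) - l (p t) := by
    refine (convex_Icc t (t + τ)).mul_sub_le_image_sub_of_le_deriv
      (fun s _ => (hlp s).continuousAt.continuousWithinAt)
      (fun s _ => (hlp s).differentiableAt.differentiableWithinAt) (fun s hs => ?_)
      t (left_mem_Icc.2 (by linarith)) (t + τ) (right_mem_Icc.2 (by linarith)) (by linarith)
    rw [(hlp s).deriv]
    exact (hball (hmem s (interior_subset hs))).le
  have := hle (t + τ)
  change l k - ε * τ < l (p t) at htl
  linarith

theorem StrictMono.hasDerivAt_leftInverse {X T : ℝ → ℝ} (hX : StrictMono X) (hXc : Continuous X)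
    (hXT : Function.LeftInverse T X) {X' t : ℝ} (hXt : HasDerivAt X X' t) (hX' : X' ≠ 0) :
    HasDerivAt T X'⁻¹ (X t) := by
  have hnear : ∀ ε > 0, ∀ᶠ x in 𝓝 (X t), ∃ s ∈ Icc (t - ε) (t + ε), X s = x := by
    intro ε hε
    filter_upwards [Ioo_mem_nhds (hX (sub_lt_self t hε)) (hX (lt_add_of_pos_right t hε))] with x hx
    exact intermediate_value_Icc (by linarith) hXc.continuousOn (Ioo_subset_Icc_self hx)
  refine HasDerivAt.of_local_left_inverse ?_ ((hXT t).symm ▸ hXt) hX' ?_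
  · rw [ContinuousAt, hXT t, Metric.nhds_basis_closedBall.tendsto_right_iff]
    intro ε hε
    filter_upwards [hnear ε hε] with x ⟨s, hs, hsx⟩
    rwa [← hsx, hXT s, Real.closedBall_eq_Icc]
  · filter_upwards [hnear 1 one_pos] with x ⟨s, _, hsx⟩
    rw [← hsx, hXT s]

/-- **Global Peano existence theorem on an open domain** (Remark 4.5).
Let `D ⊆ ℝ²` be open, `F : D → ℝ` continuous, `(a, b) ∈ D`. Then there is a solution
`y` through `(a,b)` on an open interval `(a⁻, a⁺)` whose graph lies in `D` and which
tends to the boundary of `D`: for every compact `K ⊆ D` the graph eventually leaves `K`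
near both endpoints. -/
theorem global_peano_open_domain (D : Set (ℝ × ℝ)) (hD : IsOpen D)
    (F : ℝ × ℝ → ℝ) (hF : ContinuousOn F D) (a b : ℝ) (hab : (a, b) ∈ D) :
    ∃ (am ap : EReal) (y : ℝ → ℝ),
      am < (a : EReal) ∧ (a : EReal) < ap ∧
      y a = b ∧
      (∀ x : ℝ, am < (x : EReal) → (x : EReal) < ap →
        (x, y x) ∈ D ∧ HasDerivAt y (F (x, y x)) x) ∧
      (∀ K : Set (ℝ × ℝ), K ⊆ D → IsCompact K →
        (∃ c : ℝ, (c : EReal) < ap ∧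
          ∀ x : ℝ, c < x → (x : EReal) < ap → (x, y x) ∉ K) ∧
        (∃ c' : ℝ, am < (c' : EReal) ∧
          ∀ x : ℝ, am < (x : EReal) → x < c' → (x, y x) ∉ K)) := by
  obtain ⟨φ, hφ, hG, hG1, hGD⟩ := ContinuousOn.exists_pos_smul_continuous hD
    (V := fun q => ((1 : ℝ), F q)) (continuousOn_const.prodMk hF)
  obtain ⟨p, hp0, hp⟩ := exists_solution_of_continuous_of_bounded hG hG1 (a, b)
  have hpD : ∀ t, p t ∈ D := by
    intro t
    by_contra h
    have h0 := eq_of_norm_le_norm_sub (fun x => hGD x _ h) hp rfl 0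
    exact h (h0 ▸ hp0 ▸ hab)
  have hX : ∀ t, HasDerivAt (fun s => (p s).1) (φ (p t)) t := fun t => by
    simpa [Function.comp_def] using
      (ContinuousLinearMap.fst ℝ ℝ ℝ).hasFDerivAt.comp_hasDerivAt t (hp t)
  have hY : ∀ t, HasDerivAt (fun s => (p s).2) (φ (p t) * F (p t)) t := fun t => by
    simpa [Function.comp_def] using
      (ContinuousLinearMap.snd ℝ ℝ ℝ).hasFDerivAt.comp_hasDerivAt t (hp t)
  have hXmono : StrictMono fun t => (p t).1 :=
    strictMono_of_hasDerivAt_pos hX fun t => hφ _ (hpD t)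
  have hXc : Continuous fun t => (p t).1 :=
    continuous_iff_continuousAt.2 fun t => (hX t).continuousAt
  let T : ℝ → ℝ := Function.invFun fun t => (p t).1
  have hT : Function.LeftInverse T fun t => (p t).1 := Function.leftInverse_invFun hXmono.injective
  have hgraph : ∀ t, ((p t).1, (p (T (p t).1)).2) = p t := fun t => by rw [hT t]
  have hlt : ∀ t, ((p t).1 : EReal) < ⨆ s, ((p s).1 : EReal) := fun t =>
    lt_iSup_iff.2 ⟨t + 1, EReal.coe_lt_coe_iff.2 (hXmono (lt_add_one t))⟩
  have hgt : ∀ t, ⨅ s, ((p s).1 : EReal) < ((p t).1 : EReal) := fun t =>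
    iInf_lt_iff.2 ⟨t - 1, EReal.coe_lt_coe_iff.2 (hXmono (sub_one_lt t))⟩
  have hsurj : ∀ x : ℝ, ⨅ s, ((p s).1 : EReal) < x → (x : EReal) < ⨆ s, ((p s).1 : EReal) →
      ∃ t, (p t).1 = x := by
    intro x h1 h2
    obtain ⟨s, hs⟩ := iInf_lt_iff.1 h1
    obtain ⟨u, hu⟩ := lt_iSup_iff.1 h2
    exact mem_range_of_exists_le_of_exists_ge hXc ⟨s, (EReal.coe_lt_coe_iff.1 hs).le⟩
      ⟨u, (EReal.coe_lt_coe_iff.1 hu).le⟩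
  have ha : (p 0).1 = a := by rw [hp0]
  refine ⟨⨅ s, ((p s).1 : EReal), ⨆ s, ((p s).1 : EReal), fun x => (p (T x)).2,
    ha ▸ hgt 0, ha ▸ hlt 0, ?_, fun x h1 h2 => ?_, fun K hKD hK => ⟨?_, ?_⟩⟩
  · show (p (T a)).2 = b
    rw [← ha, hT 0, hp0]
  · obtain ⟨t, rfl⟩ := hsurj x h1 h2
    have hφt := (hφ _ (hpD t)).ne'
    have hT' := hXmono.hasDerivAt_leftInverse hXc hT (hX t) hφt
    have hYT := (hY (T (p t).1)).comp (p t).1 hT'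
    rw [hT t] at hYT
    rw [hgraph]
    refine ⟨hpD t, hYT.congr_deriv ?_⟩
    field_simp
  · have hev := eventually_notMem_of_pos_on_compact hG hG1 hp (ContinuousLinearMap.fst ℝ ℝ ℝ)
      hXmono.monotone hK fun k hk => by simpa using hφ k (hKD hk)
    obtain ⟨t₀, ht₀⟩ := eventually_atTop.1 hev
    refine ⟨(p t₀).1, hlt t₀, fun x h1 h2 => ?_⟩
    obtain ⟨t, rfl⟩ := hsurj x ((hgt t₀).trans (EReal.coe_lt_coe_iff.2 h1)) h2
    rw [hgraph]
    exact ht₀ t (hXmono.lt_iff_lt.1 h1).le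
  · have hev := eventually_notMem_of_pos_on_compact hG.neg (fun x => (norm_neg _).trans_le (hG1 x))
      (p := fun t => p (-t)) (hasDerivAt_comp_neg_of_autonomous hp)
      (-ContinuousLinearMap.fst ℝ ℝ ℝ)
      (fun s t hst => neg_le_neg (hXmono.monotone (neg_le_neg hst))) hK
      fun k hk => by simpa using hφ k (hKD hk)
    obtain ⟨t₀, ht₀⟩ := eventually_atTop.1 hev
    refine ⟨(p (-t₀)).1, hgt (-t₀), fun x h1 h2 => ?_⟩
    obtain ⟨t, rfl⟩ := hsurj x h1 ((EReal.coe_lt_coe_iff.2 h2).trans (hlt (-t₀)))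
    rw [hgraph]
    simpa using ht₀ (-t) (le_neg_of_le_neg (hXmono.lt_iff_lt.1 h2).le)
end

section
/- Let F : [0,∞) × ℝ → ℝ be continuous. Then there exists a maximal solution of (*): a global solution ỹ defined on [0,a) such that for every solution y of (*) defined on [0,c) and every x ∈ [0, min{a, c}) one has ỹ(x) ≥ y(x). -/
/-- `y` is a solution of the initial value problem (*): `y 0 = 0`, `y' x = F (x, y x)`,
on the interval `[0, a)` where `0 < a ≤ ∞` (one-sided derivative at `0`). -/
def IsSolutionOn (F : ℝ × ℝ → ℝ) (a : EReal) (y : ℝ → ℝ) : Prop :=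
  0 < a ∧ y 0 = 0 ∧
    ∀ x : ℝ, 0 ≤ x → (x : EReal) < a →
      HasDerivWithinAt y (F (x, y x)) {t : ℝ | 0 ≤ t ∧ (t : EReal) < a} x

/-- A solution of (*) on `[0, a)` is global (noncontinuable) if it is not the
restriction of a solution on any `[0, a')` with `a' > a`. -/
def IsGlobalSolutionOn (F : ℝ × ℝ → ℝ) (a : EReal) (y : ℝ → ℝ) : Prop :=
  IsSolutionOn F a y ∧
    ¬ ∃ (a' : EReal) (z : ℝ → ℝ), a < a' ∧ IsSolutionOn F a' z ∧
        ∀ x : ℝ, 0 ≤ x → (x : EReal) < a → z x = y x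

open Set Filter Topology MeasureTheory
open scoped NNReal

/-- A bounded uniformly continuous function on the plane is a uniform limit of continuous functions
that are Lipschitz in the second variable. -/
lemma exists_lipschitz_snd_approx {G : ℝ × ℝ → ℝ} (hG : UniformContinuous G) {M : ℝ}
    (hM : ∀ p, |G p| ≤ M) {ε : ℝ} (hε : 0 < ε) :
    ∃ (K : ℝ≥0) (H : ℝ × ℝ → ℝ), Continuous H ∧ (∀ t, LipschitzWith K fun y => H (t, y)) ∧
      ∀ p, |H p - G p| ≤ ε := by
  obtain ⟨δ, hδ, hGδ⟩ := Metric.uniformContinuous_iff.1 hG ε hε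
  have hδ2 : 0 < δ / 2 := half_pos hδ
  set d := δ / 2 with hd
  have hM0 : 0 ≤ M := (abs_nonneg _).trans (hM 0)
  have hGc := hG.continuous
  have hint : ∀ t a b, IntervalIntegrable (fun w => G (t, w)) volume a b := fun t a b =>
    (by fun_prop : Continuous fun w => G (t, w)).intervalIntegrable a b
  refine ⟨(d⁻¹ * (2 * M)).toNNReal, fun p => d⁻¹ * ∫ w in (0 : ℝ)..d, G (p.1, p.2 + w),
    ?_, ?_, ?_⟩
  · refine continuous_const.mul
      (intervalIntegral.continuous_parametric_intervalIntegral_of_continuous'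
        (f := fun (p : ℝ × ℝ) w => G (p.1, p.2 + w)) ?_ _ _)
    exact hGc.comp (by fun_prop)
  · intro t
    refine LipschitzWith.of_dist_le_mul fun y z => ?_
    have key : |(∫ w in y..y + d, G (t, w)) - ∫ w in z..z + d, G (t, w)| ≤ 2 * M * |y - z| := by
      rw [intervalIntegral.integral_interval_sub_interval_comm (hint _ _ _) (hint _ _ _)
        (hint _ _ _)]
      have h1 := intervalIntegral.norm_integral_le_of_norm_le_const (a := y) (b := z)
        (f := fun w => G (t, w)) fun w _ => hM (t, w)
      have h2 := intervalIntegral.norm_integral_le_of_norm_le_const (a := y + d) (b := z + d)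
        (f := fun w => G (t, w)) fun w _ => hM (t, w)
      rw [add_sub_add_right_eq_sub] at h2
      rw [Real.norm_eq_abs, abs_sub_comm z y] at h1 h2
      refine (abs_sub _ _).trans ?_
      linarith
    have hcv : ∀ y, ∫ w in (0 : ℝ)..d, G (t, y + w) = ∫ w in y..y + d, G (t, w) := fun y => by
      rw [intervalIntegral.integral_comp_add_left (fun w => G (t, w)), add_zero]
    simp only [hcv, Real.dist_eq]
    rw [Real.coe_toNNReal _ (by positivity)]
    rw [← mul_sub, abs_mul, abs_of_pos (inv_pos.2 hδ2), mul_assoc]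
    exact mul_le_mul_of_nonneg_left key (inv_pos.2 hδ2).le
  · rintro ⟨t, y⟩
    have hc : Continuous fun w => G (t, y + w) := hGc.comp (by fun_prop)
    have h1 : (∫ w in (0 : ℝ)..d, (G (t, y + w) - G (t, y))) =
        (∫ w in (0 : ℝ)..d, G (t, y + w)) - d * G (t, y) := by
      rw [intervalIntegral.integral_sub (hc.intervalIntegrable _ _) (by simp)]
      simp
    have h2 : ‖∫ w in (0 : ℝ)..d, (G (t, y + w) - G (t, y))‖ ≤ ε * |d - 0| := by
      refine intervalIntegral.norm_integral_le_of_norm_le_const fun w hw => ?_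
      rw [uIoc_of_le hδ2.le] at hw
      refine (hGδ ?_).le
      rw [Prod.dist_eq, dist_self, Real.dist_eq, add_sub_cancel_left, abs_of_pos hw.1]
      exact max_lt hδ (by linarith [hw.2])
    rw [h1, sub_zero, abs_of_pos hδ2, Real.norm_eq_abs] at h2
    have h3 : d⁻¹ * (∫ w in (0 : ℝ)..d, G (t, y + w)) - G (t, y) =
        d⁻¹ * ((∫ w in (0 : ℝ)..d, G (t, y + w)) - d * G (t, y)) := by
      field_simp
    simp only [h3]
    rw [abs_mul, abs_of_pos (inv_pos.2 hδ2), inv_mul_le_iff₀ hδ2, mul_comm d ε]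
    exact h2

/-- Existence on a whole interval for a bounded vector field that is globally Lipschitz in space,
together with the a priori bound on the growth of the solution. -/
lemma exists_solution_of_lipschitz_of_bounded {H : ℝ × ℝ → ℝ} (hH : Continuous H) {K : ℝ≥0}
    (hK : ∀ t, LipschitzWith K fun y => H (t, y)) {L : ℝ} (hL : ∀ p, |H p| ≤ L) (t₀ y₀ : ℝ)
    {T : ℝ} (hT : 0 ≤ T) :
    ∃ u : ℝ → ℝ, u t₀ = y₀ ∧
      (∀ t ∈ Icc t₀ (t₀ + T), HasDerivWithinAt u (H (t, u t)) (Icc t₀ (t₀ + T)) t) ∧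
      ∀ t ∈ Icc t₀ (t₀ + T), |u t - y₀| ≤ L * T := by
  have hL0 : 0 ≤ L := (abs_nonneg _).trans (hL 0)
  have hPL : IsPicardLindelof (fun t y => H (t, y))
      (⟨t₀, left_mem_Icc.2 (by linarith)⟩ : Icc t₀ (t₀ + T)) y₀ (L * T).toNNReal 0
      L.toNNReal K :=
    { lipschitzOnWith := fun t _ => (hK t).lipschitzOnWith
      continuousOn := fun y _ => (by fun_prop : Continuous fun t => H (t, y)).continuousOn
      norm_le := fun t _ y _ => (hL (t, y)).trans (Real.le_coe_toNNReal L)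
      mul_max_le := by simp [hT, hL0, mul_nonneg hL0 hT] }
  obtain ⟨u, hu0, hu⟩ := hPL.exists_eq_forall_mem_Icc_hasDerivWithinAt₀
  refine ⟨u, hu0, hu, fun t ht => ?_⟩
  have := norm_image_sub_le_of_norm_deriv_le_segment' hu (fun s _ => hL (s, u s)) t ht
  simp only at hu0
  rw [hu0] at this
  exact this.trans (mul_le_mul_of_nonneg_left (by linarith [ht.2]) hL0)

/-- The maximal local solution for a bounded uniformly continuous vector field `G`, obtained as the
decreasing limit of solutions for Lipschitz vector fields lying strictly above `G`. A competitor
`v` only has to solve the equation where it is within distance `(M + 3) * T` of `y₀`. -/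
lemma exists_maximal_solution_of_bounded {G : ℝ × ℝ → ℝ} (hG : UniformContinuous G) {M : ℝ}
    (hM : ∀ p, |G p| ≤ M) (t₀ y₀ : ℝ) {T : ℝ} (hT : 0 ≤ T) :
    ∃ m : ℝ → ℝ, m t₀ = y₀ ∧
      (∀ t ∈ Icc t₀ (t₀ + T), |m t - y₀| ≤ (M + 3) * T) ∧
      (∀ t ∈ Icc t₀ (t₀ + T), HasDerivWithinAt m (G (t, m t)) (Icc t₀ (t₀ + T)) t) ∧
      ∀ b ≤ t₀ + T, ∀ v v' : ℝ → ℝ, ContinuousOn v (Icc t₀ b) → v t₀ ≤ y₀ →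
        (∀ t ∈ Ico t₀ b, HasDerivWithinAt v (v' t) (Ici t) t) →
        (∀ t ∈ Ico t₀ b, |v t - y₀| ≤ (M + 3) * T → v' t = G (t, v t)) →
        ∀ t ∈ Icc t₀ b, v t ≤ m t := by
  set e : ℕ → ℝ := fun n => (1 / 4) ^ n with he
  have he0 : ∀ n, 0 < e n := fun n => by positivity
  have he1 : ∀ n, e n ≤ 1 := fun n => pow_le_one₀ (by norm_num) (by norm_num)
  have hes : ∀ n, e (n + 1) = e n / 4 := fun n => by simp only [he, pow_succ]; ring
  have helim : Tendsto e atTop (𝓝 0) :=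
    tendsto_pow_atTop_nhds_zero_of_lt_one (by norm_num) (by norm_num)
  have happ : ∀ n, ∃ (K : ℝ≥0) (H : ℝ × ℝ → ℝ), Continuous H ∧
      (∀ t, LipschitzWith K fun y => H (t, y)) ∧
      ∀ p, G p + e n ≤ H p ∧ H p ≤ G p + 3 * e n := fun n => by
    obtain ⟨K, H, hH, hK, hHG⟩ := exists_lipschitz_snd_approx hG hM (he0 n)
    refine ⟨K, fun p => H p + 2 * e n, by fun_prop, fun t => ?_, fun p => ?_⟩
    · simpa using (hK t).add (LipschitzWith.const (2 * e n))
    · have := abs_le.1 (hHG p)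
      constructor <;> linarith
  choose K H hHc hHK hHG using happ
  have hHM : ∀ n p, |H n p| ≤ M + 3 := fun n p => by
    have h1 := hHG n p
    have h2 := abs_le.1 (hM p)
    have h3 := he0 n
    have h4 := he1 n
    exact abs_le.2 ⟨by linarith, by linarith⟩
  choose u hu0 hu hub using fun n =>
    exists_solution_of_lipschitz_of_bounded (hHc n) (hHK n) (hHM n) t₀ y₀ hT
  have huc : ∀ n, ContinuousOn (u n) (Icc t₀ (t₀ + T)) := fun n =>
    HasDerivWithinAt.continuousOn (hu n)
  have hur : ∀ n, ∀ t ∈ Ico t₀ (t₀ + T), HasDerivWithinAt (u n) (H n (t, u n t)) (Ici t) t :=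
    fun n t ht => (hu n t (Ico_subset_Icc_self ht)).mono_of_mem_nhdsWithin
      (Icc_mem_nhdsGE_of_mem ht)
  have hdom : ∀ n, ∀ b ≤ t₀ + T, ∀ v v' : ℝ → ℝ, ContinuousOn v (Icc t₀ b) → v t₀ ≤ y₀ →
      (∀ t ∈ Ico t₀ b, HasDerivWithinAt v (v' t) (Ici t) t) →
      (∀ t ∈ Ico t₀ b, |v t - y₀| ≤ (M + 3) * T → v' t < H n (t, v t)) →
      ∀ t ∈ Icc t₀ b, v t ≤ u n t := by
    intro n b hb v v' hv hv0 hv' hvH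
    refine image_le_of_deriv_right_lt_deriv_boundary' hv hv' (hv0.trans_eq (hu0 n).symm)
      ((huc n).mono (Icc_subset_Icc_right hb))
      (fun t ht => hur n t ⟨ht.1, ht.2.trans_le hb⟩) fun t ht htu => ?_
    rw [← htu]
    exact hvH t ht (htu ▸ hub n t ⟨ht.1, (ht.2.trans_le hb).le⟩)
  have hanti : ∀ t ∈ Icc t₀ (t₀ + T), Antitone fun n => u n t := fun t ht =>
    antitone_nat_of_succ_le fun n => hdom n _ le_rfl _ _ (huc (n + 1)) (hu0 (n + 1)).le
      (hur (n + 1)) (fun s _ _ => by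
        have h1 := (hHG (n + 1) (s, u (n + 1) s)).2
        have h2 := (hHG n (s, u (n + 1) s)).1
        have h3 := hes n
        have h4 := he0 n
        linarith) t ht
  have hlim : ∀ t ∈ Icc t₀ (t₀ + T), Tendsto (fun n => u n t) atTop (𝓝 (⨅ n, u n t)) :=
    fun t ht => tendsto_atTop_ciInf (hanti t ht)
      ⟨y₀ - (M + 3) * T, by
        rintro _ ⟨n, rfl⟩
        have := (abs_le.1 (hub n t ht)).1
        simp only
        linarith⟩
  set m : ℝ → ℝ := fun t => ⨅ n, u n t with hm
  have ht₀ : t₀ ∈ Icc t₀ (t₀ + T) := left_mem_Icc.2 (by linarith)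
  have hm0 : m t₀ = y₀ := by simp [hm, hu0]
  have hML : 0 ≤ M + 3 := (abs_nonneg _).trans (hHM 0 0)
  have hmc : ContinuousOn m (Icc t₀ (t₀ + T)) := by
    refine LipschitzOnWith.continuousOn (K := (M + 3).toNNReal)
      (LipschitzOnWith.of_dist_le_mul fun s hs t ht => ?_)
    refine le_of_tendsto ((hlim s hs).dist (hlim t ht)) (Eventually.of_forall fun n => ?_)
    rw [Real.coe_toNNReal _ hML]
    exact (convex_Icc _ _).norm_image_sub_le_of_norm_hasDerivWithin_le (hu n)
      (fun x _ => hHM n _) ht hs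
  have hpic : ∀ t ∈ Icc t₀ (t₀ + T), m t = ODE.picard (fun t y => G (t, y)) t₀ y₀ m t := by
    intro t ht
    have hsub : uIcc t₀ t ⊆ Icc t₀ (t₀ + T) := uIcc_subset_Icc ht₀ ht
    refine tendsto_nhds_unique (hlim t ht) ?_
    have hun : ∀ n, y₀ + ∫ s in t₀..t, H n (s, u n s) = u n t := fun n => by
      have := ODE.picard_eq_of_hasDerivAt (f := fun t y => H n (t, y)) (u := univ)
        (hHc n).continuousOn (fun s hs => (hu n s (hsub hs)).mono hsub) (mapsTo_univ _ _)
      rwa [hu0, ODE.picard_apply] at this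
    simp only [ODE.picard_apply, ← hun]
    refine tendsto_const_nhds.add
      (intervalIntegral.tendsto_integral_filter_of_dominated_convergence (fun _ => M + 3)
        (Eventually.of_forall fun n => ?_) (Eventually.of_forall fun n => ?_) (by simp) ?_)
    · refine ContinuousOn.aestronglyMeasurable ?_ measurableSet_uIoc
      exact ((hHc n).comp_continuousOn (continuousOn_id.prodMk (huc n))).mono
        (uIoc_subset_uIcc.trans hsub)
    · exact Eventually.of_forall fun s _ => hHM n _
    · refine Eventually.of_forall fun s hs => ?_
      have hGs : Tendsto (fun n => G (s, u n s)) atTop (𝓝 (G (s, m s))) :=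
        (hG.continuous.tendsto _).comp
          (tendsto_const_nhds.prodMk_nhds (hlim s (hsub (uIoc_subset_uIcc hs))))
      refine tendsto_of_tendsto_of_tendsto_of_le_of_le hGs
        (by simpa using hGs.add (helim.const_mul 3)) (fun n => ?_) fun n => (hHG n _).2
      linarith [(hHG n (s, u n s)).1, he0 n]
  refine ⟨m, hm0, fun t ht => ?_, fun t ht => ?_, fun b hb v v' hv hv0 hv' hvG t ht => ?_⟩
  · exact le_of_tendsto ((hlim t ht).sub_const y₀).abs (Eventually.of_forall fun n => hub n t ht)
  · exact (ODE.hasDerivWithinAt_picard_Icc (f := fun t y => G (t, y)) (u := univ) ht₀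
      hG.continuous.continuousOn hmc (fun _ _ => mem_univ _) y₀ ht).congr_of_mem hpic ht
  · refine ge_of_tendsto' (hlim t ⟨ht.1, ht.2.trans hb⟩) fun n => ?_
    refine hdom n b hb v v' hv hv0 hv' (fun s hs hsv => ?_) t ht
    rw [hvG s hs hsv]
    linarith [(hHG n (s, v s)).1, he0 n]

/-- Local existence of a maximal solution through any point of the domain of `F`. -/
lemma exists_local_maximal_solution {F : ℝ × ℝ → ℝ}
    (hF : ContinuousOn F (Ici (0 : ℝ) ×ˢ (univ : Set ℝ))) {t₀ : ℝ} (ht₀ : 0 ≤ t₀) (y₀ : ℝ) :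
    ∃ δ > 0, ∃ m : ℝ → ℝ, m t₀ = y₀ ∧
      (∀ t ∈ Icc t₀ (t₀ + δ), HasDerivWithinAt m (F (t, m t)) (Icc t₀ (t₀ + δ)) t) ∧
      ∀ b ≤ t₀ + δ, ∀ v : ℝ → ℝ, v t₀ ≤ y₀ →
        (∀ t ∈ Icc t₀ b, HasDerivWithinAt v (F (t, v t)) (Icc t₀ b) t) →
        ∀ t ∈ Icc t₀ b, v t ≤ m t := by
  have h1 : t₀ ≤ t₀ + 1 := by linarith
  have h2 : y₀ - 1 ≤ y₀ + 1 := by linarith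
  let F' : Icc t₀ (t₀ + 1) × Icc (y₀ - 1) (y₀ + 1) → ℝ := fun p => F (p.1, p.2)
  have hF' : Continuous F' := hF.comp_continuous (by fun_prop)
    fun p => ⟨ht₀.trans p.1.2.1, mem_univ _⟩
  have hproj : UniformContinuous fun p : ℝ × ℝ => (projIcc _ _ h1 p.1, projIcc _ _ h2 p.2) :=
    ((LipschitzWith.projIcc h1).uniformContinuous.comp uniformContinuous_fst).prodMk
      ((LipschitzWith.projIcc h2).uniformContinuous.comp uniformContinuous_snd)
  obtain ⟨M, hM⟩ := isCompact_univ.exists_bound_of_continuousOn hF'.continuousOn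
  have hM0 : 0 ≤ M := (norm_nonneg _).trans
    (hM (projIcc _ _ h1 0, projIcc _ _ h2 0) (mem_univ _))
  have hδ : 0 < 1 / (M + 3) := by positivity
  have hδ1 : 1 / (M + 3) ≤ 1 := by rw [div_le_one (by positivity)]; linarith
  have hMδ : (M + 3) * (1 / (M + 3)) = 1 := by field_simp
  set δ := 1 / (M + 3)
  obtain ⟨m, hm0, hmb, hm, hmax⟩ := exists_maximal_solution_of_bounded
    ((CompactSpace.uniformContinuous_of_continuous hF').comp hproj) (fun p => hM _ (mem_univ _))
    t₀ y₀ hδ.le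
  have hG : ∀ t ∈ Icc t₀ (t₀ + δ), ∀ y, |y - y₀| ≤ (M + 3) * δ →
      F' (projIcc _ _ h1 t, projIcc _ _ h2 y) = F (t, y) := fun t ht y hy => by
    rw [hMδ, abs_le] at hy
    rw [projIcc_of_mem h1 ⟨ht.1, ht.2.trans (by linarith)⟩,
      projIcc_of_mem h2 ⟨by linarith, by linarith⟩]
  refine ⟨δ, hδ, m, hm0, fun t ht => ?_, fun b hb v hv0 hv => ?_⟩
  · rw [← hG t ht _ (hmb t ht)]
    exact hm t ht
  · exact hmax b hb v _ (HasDerivWithinAt.continuousOn hv) hv0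
      (fun t ht => (hv t (Ico_subset_Icc_self ht)).mono_of_mem_nhdsWithin
        (Icc_mem_nhdsGE_of_mem ht))
      fun t ht hvt => (hG t ⟨ht.1, ht.2.le.trans hb⟩ _ hvt).symm

/-- A solution on `[0, a)` dominating every solution on the intersection of the domains. -/
def IsDominatingSolutionOn (F : ℝ × ℝ → ℝ) (a : EReal) (u : ℝ → ℝ) : Prop :=
  IsSolutionOn F a u ∧ ∀ (c : EReal) (y : ℝ → ℝ), IsSolutionOn F c y →
    ∀ x : ℝ, 0 ≤ x → (x : EReal) < a → (x : EReal) < c → y x ≤ u x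

lemma IsSolutionOn.hasDerivWithinAt_Icc {F : ℝ × ℝ → ℝ} {a : EReal} {y : ℝ → ℝ}
    (h : IsSolutionOn F a y) {s b : ℝ} (hs : 0 ≤ s) (hb : (b : EReal) < a) :
    ∀ t ∈ Icc s b, HasDerivWithinAt y (F (t, y t)) (Icc s b) t := by
  have hlt : ∀ t ∈ Icc s b, (t : EReal) < a := fun t ht =>
    (EReal.coe_le_coe_iff.2 ht.2).trans_lt hb
  exact fun t ht => (h.2.2 t (hs.trans ht.1) (hlt t ht)).mono
    fun r hr => ⟨hs.trans hr.1, hlt r hr⟩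

/-- A solution on the compact interval `[0, A]` that dominates all others there extends to a
dominating solution on a strictly larger interval. -/
lemma exists_isDominatingSolutionOn_extension {F : ℝ × ℝ → ℝ}
    (hF : ContinuousOn F (Ici (0 : ℝ) ×ˢ (univ : Set ℝ))) {A : ℝ} (hA : 0 ≤ A) {z : ℝ → ℝ}
    (hz0 : z 0 = 0) (hz : ∀ t ∈ Icc 0 A, HasDerivWithinAt z (F (t, z t)) (Icc 0 A) t)
    (hdom : ∀ (c : EReal) (y : ℝ → ℝ), IsSolutionOn F c y →
      ∀ x ∈ Icc 0 A, (x : EReal) < c → y x ≤ z x) :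
    ∃ A' > A, ∃ w, IsDominatingSolutionOn F (A' : ℝ) w := by
  obtain ⟨δ, hδ, m, hm0, hm, hmax⟩ := exists_local_maximal_solution hF hA (z A)
  let w : ℝ → ℝ := fun t => if t ≤ A then z t else m t
  have hwz : ∀ t ∈ Icc 0 A, w t = z t := fun t ht => if_pos ht.2
  have hwm : ∀ t ∈ Icc A (A + δ), w t = m t := fun t ht => by
    rcases ht.1.eq_or_lt with rfl | h
    · simp [w, hm0]
    · exact if_neg h.not_ge
  refine ⟨A + δ, by linarith, w, ⟨?_, ?_, fun x hx0 hx => ?_⟩, fun c y hy x hx0 hx hxc => ?_⟩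
  · exact_mod_cast (by linarith : (0 : ℝ) < A + δ)
  · rw [hwz 0 ⟨le_rfl, hA⟩, hz0]
  · have hL : HasDerivWithinAt w (F (x, w x)) (Icc 0 A) x := by
      by_cases h : x ∈ Icc 0 A
      · rw [hwz x h]
        exact (hz x h).congr_of_mem hwz h
      · exact HasFDerivWithinAt.of_notMem_closure (by rwa [isClosed_Icc.closure_eq])
    have hR : HasDerivWithinAt w (F (x, w x)) (Icc A (A + δ)) x := by
      by_cases h : x ∈ Icc A (A + δ)
      · rw [hwm x h]
        exact (hm x h).congr_of_mem hwm h
      · exact HasFDerivWithinAt.of_notMem_closure (by rwa [isClosed_Icc.closure_eq])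
    refine (hL.union hR).mono fun t ht => ?_
    rw [Icc_union_Icc_eq_Icc hA (by linarith)]
    exact ⟨ht.1, (EReal.coe_lt_coe_iff.1 ht.2).le⟩
  · have hx' := EReal.coe_lt_coe_iff.1 hx
    rcases le_total x A with h | h
    · rw [hwz x ⟨hx0, h⟩]
      exact hdom c y hy x ⟨hx0, h⟩ hxc
    · rw [hwm x ⟨h, hx'.le⟩]
      exact hmax x hx'.le y (hdom c y hy A ⟨hA, le_rfl⟩
        ((EReal.coe_le_coe_iff.2 h).trans_lt hxc))
        (hy.hasDerivWithinAt_Icc hA hxc) x ⟨h, le_rfl⟩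

/-- **Existence of the maximal solution** (existence part of the global Osgood theorem,
Theorem 6.2). Let `F : [0,∞) × ℝ → ℝ` be continuous. There is a global solution `ym` of
(*) on some `[0, a)` that dominates every solution of (*) pointwise on the intersection
of their domains. -/
theorem maximal_solution_exists (F : ℝ × ℝ → ℝ)
    (hF : ContinuousOn F (Set.Ici (0 : ℝ) ×ˢ (Set.univ : Set ℝ))) :
    ∃ (a : EReal) (ym : ℝ → ℝ), IsGlobalSolutionOn F a ym ∧
      ∀ (c : EReal) (y : ℝ → ℝ), IsSolutionOn F c y →
        ∀ x : ℝ, 0 ≤ x → (x : EReal) < a → (x : EReal) < c → y x ≤ ym x := by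
  let S : Set EReal := {a | ∃ u, IsDominatingSolutionOn F a u}
  obtain ⟨A₀, hA₀, u₀, hu₀⟩ : ∃ A' > (0 : ℝ), ∃ w, IsDominatingSolutionOn F (A' : ℝ) w := by
    refine exists_isDominatingSolutionOn_extension hF le_rfl (z := fun _ => 0) rfl
      (fun t _ => ?_) fun c y hy x hx _ => ?_
    · rw [Icc_self]
      exact HasFDerivWithinAt.of_subsingleton subsingleton_singleton
    · rw [le_antisymm hx.2 hx.1]
      exact hy.2.1.le
  have hex : ∀ x : ℝ, ∃ u : ℝ → ℝ, (x : EReal) < sSup S →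
      ∃ a, (x : EReal) < a ∧ IsDominatingSolutionOn F a u := fun x => by
    by_cases h : (x : EReal) < sSup S
    · obtain ⟨a, ⟨u, hu⟩, hxa⟩ := lt_sSup_iff.1 h
      exact ⟨u, fun _ => ⟨a, hxa, hu⟩⟩
    · exact ⟨0, fun h' => (h h').elim⟩
  choose U hU using hex
  let ym : ℝ → ℝ := fun x => U x x
  have hym : ∀ a u, IsDominatingSolutionOn F a u →
      ∀ x : ℝ, 0 ≤ x → (x : EReal) < a → ym x = u x := by
    intro a u hu x hx hxa
    obtain ⟨a', hxa', hu'⟩ := hU x (hxa.trans_le (le_sSup ⟨u, hu⟩))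
    exact le_antisymm (hu.2 a' _ hu'.1 x hx hxa hxa') (hu'.2 a u hu.1 x hx hxa' hxa)
  have hpos : 0 < sSup S := hu₀.1.1.trans_le (le_sSup ⟨u₀, hu₀⟩)
  have hdom : ∀ (c : EReal) (y : ℝ → ℝ), IsSolutionOn F c y →
      ∀ x : ℝ, 0 ≤ x → (x : EReal) < sSup S → (x : EReal) < c → y x ≤ ym x := by
    intro c y hy x hx hxS hxc
    obtain ⟨a, hxa, hu⟩ := hU x hxS
    exact hu.2 c y hy x hx hxa hxc
  refine ⟨sSup S, ym, ⟨⟨hpos, ?_, fun x hx hxS => ?_⟩, ?_⟩, hdom⟩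
  · rw [hym _ _ hu₀ 0 le_rfl hu₀.1.1, hu₀.1.2.1]
  · obtain ⟨a, hxa, hu⟩ := hU x hxS
    have h := (hu.1.2.2 x hx hxa).congr_of_mem (fun t ht => hym a _ hu t ht.1 ht.2) ⟨hx, hxa⟩
    refine h.mono_of_mem_nhdsWithin ?_
    filter_upwards [self_mem_nhdsWithin, mem_nhdsWithin_of_mem_nhds
      ((isOpen_Iio.preimage continuous_coe_real_ereal).mem_nhds hxa)] with t ht hta
    exact ⟨ht.1, hta⟩
  · rintro ⟨a', z, ha', hz, hzy⟩
    have hcoe : ((sSup S).toReal : EReal) = sSup S :=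
      EReal.coe_toReal (ha'.trans_le le_top).ne (bot_le.trans_lt hpos).ne'
    set A := (sSup S).toReal
    have hA : 0 < A := by rw [← hcoe] at hpos; exact_mod_cast hpos
    obtain ⟨A', hA', w, hw⟩ := exists_isDominatingSolutionOn_extension hF hA.le hz.2.1
      (hz.hasDerivWithinAt_Icc le_rfl (hcoe ▸ ha')) fun c y hy x hx hxc => by
        have hlt : ∀ t ∈ Ico 0 A, (t : EReal) < c → y t ≤ z t := fun t ht htc => by
          have htS : (t : EReal) < sSup S := hcoe ▸ EReal.coe_lt_coe_iff.2 ht.2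
          exact (hdom c y hy t ht.1 htS htc).trans_eq (hzy t ht.1 htS).symm
        rcases hx.2.lt_or_eq with h | rfl
        · exact hlt x ⟨hx.1, h⟩ hxc
        · refine ContinuousWithinAt.closure_le (s := Ico 0 A) (by rwa [closure_Ico hA.ne])
            ((hy.hasDerivWithinAt_Icc le_rfl hxc A hx).continuousWithinAt.mono Ico_subset_Icc_self)
            ((hz.hasDerivWithinAt_Icc le_rfl (hcoe ▸ ha') A hx).continuousWithinAt.mono
              Ico_subset_Icc_self)
            fun t ht => hlt t ht ((EReal.coe_lt_coe_iff.2 ht.2).trans hxc)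
    exact (EReal.coe_lt_coe_iff.2 hA').not_ge (hcoe ▸ le_sSup ⟨w, hw⟩)
end

section
/- Let F : [0,∞) × ℝ → ℝ be a function, let x₀ ≥ 0, y₀ ∈ ℝ, h > 0, and for k ∈ ℕ set x_k = x₀ + k·h. Let (ε_k) be reals with |ε_k| ≤ ε for all k, and define (y_k) recursively by y_{k+1} = y_k + (F(x_k, y_k) + ε_k)·h. Fix p ∈ ℕ and suppose c, d, M > 0 are such that |F(t,s)| ≤ M for all (t,s) ∈ [x_p, x_p + c] × [y_p − d, y_p + d], and let e be real with 0 < e ≤ min{c, d/(M+ε)}. Then for all k, ℓ ≥ p with x_k, x_ℓ ∈ [x_p, x_p + e): y_k ∈ [y_p − d, y_p + d] and |y_k − y_ℓ| ≤ (M + ε)·|x_k − x_ℓ|. -/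
/-- A real sequence whose steps between `m` and `n` are bounded by `C` moves by at most
`C * (n - m)`. -/
theorem abs_sub_le_mul_of_abs_step_le {u : ℕ → ℝ} {C : ℝ} {m n : ℕ} (hmn : m ≤ n)
    (hu : ∀ k, m ≤ k → k < n → |u (k + 1) - u k| ≤ C) :
    |u n - u m| ≤ C * ((n : ℝ) - m) := by
  have hsum := dist_le_Ico_sum_of_dist_le (f := u) hmn (d := fun _ => C) fun {k} hmk hkn => by
    rw [dist_comm, Real.dist_eq]
    exact hu k hmk hkn
  rw [dist_comm, Real.dist_eq, Finset.sum_const, Nat.card_Ico, nsmul_eq_mul,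
    Nat.cast_sub hmn] at hsum
  linarith

/-- **Estimate for perturbed Euler polygons** (finitary content of Lemma 4.2).
Given the grid `x k = x₀ + k·h` (`h > 0`), perturbations `|εs k| ≤ ε`, and the Euler
recursion `y (k+1) = y k + (F (x k, y k) + εs k)·h`: if `|F| ≤ M` on
`[x p, x p + c] × [y p - d, y p + d]` and `0 < e ≤ min {c, d/(M+ε)}`, then for all
`k, ℓ ≥ p` with `x k, x ℓ ∈ [x p, x p + e)` one has `y k ∈ [y p - d, y p + d]` and
`|y k - y ℓ| ≤ (M + ε)·|x k - x ℓ|`. -/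
theorem euler_polygon_estimate (F : ℝ × ℝ → ℝ) (x₀ y₀ h : ℝ)
    (hx₀ : 0 ≤ x₀) (hh : 0 < h)
    (ε : ℝ) (hε : 0 ≤ ε) (εs : ℕ → ℝ) (hεs : ∀ k, |εs k| ≤ ε)
    (x y : ℕ → ℝ) (hx : ∀ k, x k = x₀ + k * h) (hy₀ : y 0 = y₀)
    (hy : ∀ k, y (k + 1) = y k + (F (x k, y k) + εs k) * h)
    (p : ℕ) (c d M : ℝ) (hc : 0 < c) (hd : 0 < d) (hM : 0 < M)
    (hFb : ∀ t ∈ Set.Icc (x p) (x p + c), ∀ s ∈ Set.Icc (y p - d) (y p + d),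
      |F (t, s)| ≤ M)
    (e : ℝ) (he0 : 0 < e) (he : e ≤ min c (d / (M + ε))) :
    ∀ k ℓ : ℕ, p ≤ k → p ≤ ℓ → x k < x p + e → x ℓ < x p + e →
      y k ∈ Set.Icc (y p - d) (y p + d) ∧ |y k - y ℓ| ≤ (M + ε) * |x k - x ℓ| := by
  have hMε : 0 < M + ε := by linarith
  have hed : (M + ε) * e ≤ d := by
    have := (le_div_iff₀ hMε).mp (he.trans (min_le_right _ _))
    linarith
  have hec : e ≤ c := he.trans (min_le_left _ _)
  have hx_sub : ∀ k ℓ, x k - x ℓ = ((k : ℝ) - ℓ) * h := fun k ℓ => by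
    rw [hx, hx]
    ring
  have hx_mono : Monotone x := fun k ℓ hkℓ => by
    have hcast : (k : ℝ) ≤ ℓ := Nat.cast_le.mpr hkℓ
    have := mul_nonneg (sub_nonneg.mpr hcast) hh.le
    linarith [hx_sub ℓ k]
  have step : ∀ k, p ≤ k → x k < x p + e → y k ∈ Set.Icc (y p - d) (y p + d) →
      |y (k + 1) - y k| ≤ (M + ε) * h := fun k hpk hk hyk => by
    have hF := hFb (x k) ⟨hx_mono hpk, by linarith⟩ (y k) hyk
    rw [hy, add_sub_cancel_left, abs_mul, abs_of_pos hh]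
    gcongr
    exact (abs_add_le _ _).trans (add_le_add hF (hεs k))
  have mem : ∀ k, p ≤ k → x k < x p + e → y k ∈ Set.Icc (y p - d) (y p + d) := by
    intro k
    induction k using Nat.strong_induction_on with
    | _ k ih =>
      intro hpk hk
      have hyk := abs_sub_le_mul_of_abs_step_le hpk fun j hpj hjk =>
        have hj := (hx_mono hjk.le).trans_lt hk
        step j hpj hj (ih j hjk hpj hj)
      have hke : (M + ε) * (x k - x p) ≤ (M + ε) * e := by
        gcongr
        linarith
      rw [hx_sub] at hke
      obtain ⟨hl, hr⟩ := abs_le.mp (hyk.trans (by linarith : _ ≤ d))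
      constructor <;> linarith
  have lip : ∀ k ℓ, p ≤ k → k ≤ ℓ → x ℓ < x p + e →
      |y ℓ - y k| ≤ (M + ε) * |x ℓ - x k| := fun k ℓ hpk hkℓ hℓ => by
    have hyℓ := abs_sub_le_mul_of_abs_step_le hkℓ fun j hkj hjℓ =>
      have hpj := hpk.trans hkj
      have hj := (hx_mono hjℓ.le).trans_lt hℓ
      step j hpj hj (mem j hpj hj)
    rw [abs_of_nonneg (sub_nonneg.mpr (hx_mono hkℓ)), hx_sub]
    linarith
  intro k ℓ hpk hpℓ hk hℓ
  refine ⟨mem k hpk hk, ?_⟩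
  rcases le_total k ℓ with hkℓ | hℓk
  · rw [abs_sub_comm (y k), abs_sub_comm (x k)]
    exact lip k ℓ hpk hkℓ hℓ
  · exact lip ℓ k hpℓ hℓk hk
end

section
/- Let F : [0,∞) × ℝ → ℝ be continuous and let y be a noncontinuable (global) solution of (*) defined on [0,a) with a < ∞. Then y(x) tends to +∞ or to −∞ as x → a⁻. -/
open Filter Topology Set

/-- The Euler polygon for `u' = G (t, u)`, `u 0 = c`, with step `h`, at its `k`-th node. -/
noncomputable def eulerSeq (G : ℝ × ℝ → ℝ) (c h : ℝ) : ℕ → ℝ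
  | 0 => c
  | k + 1 => eulerSeq G c h k + h * G (k * h, eulerSeq G c h k)

theorem abs_eulerSeq_add_sub_le {G : ℝ × ℝ → ℝ} {c h v ε : ℝ} (hh : 0 ≤ h) (j m : ℕ)
    (H : ∀ i, j ≤ i → i < j + m → |G (i * h, eulerSeq G c h i) - v| ≤ ε) :
    |eulerSeq G c h (j + m) - eulerSeq G c h j - v * (h * m)| ≤ ε * (h * m) := by
  induction m with
  | zero => simp
  | succ m ih =>
    have h1 := ih fun i hi hi' => H i hi (by omega)
    have h2 := mul_le_mul_of_nonneg_left (H (j + m) (by omega) (by omega)) hh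
    rw [← abs_of_nonneg hh, ← abs_mul, abs_of_nonneg hh] at h2
    have h3 : eulerSeq G c h (j + (m + 1)) = eulerSeq G c h (j + m) +
      h * G ((j + m : ℕ) * h, eulerSeq G c h (j + m)) := rfl
    rw [h3]
    rw [abs_le] at *
    push_cast at *
    constructor <;> linarith

theorem abs_eulerSeq_sub_sub_le {G : ℝ × ℝ → ℝ} {c h v ε : ℝ} (hh : 0 ≤ h) (j k : ℕ)
    (H : ∀ i, min j k ≤ i → i < max j k → |G (i * h, eulerSeq G c h i) - v| ≤ ε) :
    |eulerSeq G c h k - eulerSeq G c h j - v * (k * h - j * h)| ≤ ε * |k * h - j * h| := by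
  rcases le_total j k with hjk | hjk
  · obtain ⟨m, rfl⟩ := Nat.exists_eq_add_of_le hjk
    have h1 := abs_eulerSeq_add_sub_le hh j m fun i hi hi' => H i (by omega) (by omega)
    have h2 : ((j + m : ℕ) : ℝ) * h - j * h = h * m := by push_cast; ring
    rwa [h2, abs_of_nonneg (a := h * m) (by positivity)]
  · obtain ⟨m, rfl⟩ := Nat.exists_eq_add_of_le hjk
    have h1 := abs_eulerSeq_add_sub_le hh k m fun i hi hi' => H i (by omega) (by omega)
    have h2 : (k : ℝ) * h - (k + m : ℕ) * h = - (h * m) := by push_cast; ring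
    rw [h2, abs_neg, abs_of_nonneg (a := h * m) (by positivity), abs_sub_comm]
    rw [abs_le] at *
    constructor <;> linarith

theorem abs_eulerSeq_sub_le {G : ℝ × ℝ → ℝ} {c h M : ℝ} (hM : ∀ p, |G p| ≤ M) (hh : 0 ≤ h)
    (j k : ℕ) : |eulerSeq G c h k - eulerSeq G c h j| ≤ M * |k * h - j * h| := by
  simpa using abs_eulerSeq_sub_sub_le (v := 0) hh j k fun i _ _ => by simpa using hM _

theorem abs_eulerSeq_sub_sub_le_of_near {G : ℝ × ℝ → ℝ} {c h v ε M x l δ η : ℝ}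
    (hM : ∀ p, |G p| ≤ M) (hh : 0 ≤ h) (hδ : (2 * M + 1) * δ ≤ η)
    (H : ∀ s u, |s - x| < η → |u - l| < η → |G (s, u) - v| ≤ ε) {j k : ℕ}
    (hj : |j * h - x| < δ) (hk : |k * h - x| < δ) (hl : |eulerSeq G c h j - l| < δ) :
    |eulerSeq G c h k - eulerSeq G c h j - v * (k * h - j * h)| ≤ ε * |k * h - j * h| := by
  have hM0 : 0 ≤ M := (abs_nonneg _).trans (hM 0)
  have hδ0 : 0 < δ := (abs_nonneg _).trans_lt hj
  have hMδ : 0 ≤ M * δ := by positivity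
  refine abs_eulerSeq_sub_sub_le hh j k fun i hi hi' => ?_
  rw [abs_lt] at hj hk hl
  have hix : |i * h - x| < δ ∧ |i * h - j * h| ≤ 2 * δ := by
    rw [abs_lt, abs_le]
    rcases le_total j k with hjk | hjk
    · have h1 : (j : ℝ) * h ≤ i * h := by gcongr; omega
      have h2 : (i : ℝ) * h ≤ k * h := by gcongr; omega
      refine ⟨⟨?_, ?_⟩, ?_, ?_⟩ <;> linarith
    · have h1 : (k : ℝ) * h ≤ i * h := by gcongr; omega
      have h2 : (i : ℝ) * h ≤ j * h := by gcongr; omega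
      refine ⟨⟨?_, ?_⟩, ?_, ?_⟩ <;> linarith
  have h3 := (abs_eulerSeq_sub_le (c := c) hM hh j i).trans
    (mul_le_mul_of_nonneg_left hix.2 hM0)
  refine H _ _ (hix.1.trans_le (by linarith)) ?_
  rw [abs_le] at h3
  rw [abs_lt]
  constructor <;> linarith

/-- **Peano's existence theorem** for a bounded continuous right-hand side. -/
theorem exists_hasDerivWithinAt_of_continuous_of_bounded {G : ℝ × ℝ → ℝ} (hG : Continuous G)
    {M : ℝ} (hM : ∀ p, |G p| ≤ M) (c : ℝ) :
    ∃ w : ℝ → ℝ, w 0 = c ∧ ∀ x, 0 ≤ x → HasDerivWithinAt w (G (x, w x)) (Ici 0) x := by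
  have hM0 : 0 ≤ M := (abs_nonneg _).trans (hM 0)
  let h : ℕ → ℝ := fun n => 1 / ((n : ℝ) + 1)
  have hh : ∀ n, 0 ≤ h n := fun n => by positivity
  let K : ℝ → ℕ → ℕ := fun x n => ⌊x * ((n : ℝ) + 1)⌋₊
  have hKx : ∀ x, 0 ≤ x → ∀ n, K x n * h n ≤ x := fun x hx n => by
    have := Nat.floor_le (a := x * ((n : ℝ) + 1)) (by positivity)
    simp only [K, h]
    rw [mul_one_div, div_le_iff₀ (by positivity)]
    exact this
  let U : Ultrafilter ℕ := hyperfilter ℕ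
  have hU : (U : Filter ℕ) ≤ atTop := Nat.hyperfilter_le_atTop
  have hKlim : ∀ x, 0 ≤ x → Tendsto (fun n => K x n * h n) U (𝓝 x) := fun x hx => by
    have h1 : Tendsto (fun n : ℕ => (n : ℝ) + 1) atTop atTop :=
      tendsto_atTop_add_const_right _ _ tendsto_natCast_atTop_atTop
    have h2 := ((tendsto_nat_floor_mul_div_atTop hx).comp h1).mono_left hU
    refine h2.congr fun n => ?_
    simp [K, h, div_eq_mul_inv]
  have hlim : ∀ x, ∃ l, 0 ≤ x → Tendsto (fun n => eulerSeq G c (h n) (K x n)) U (𝓝 l) := by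
    intro x
    by_cases hx : 0 ≤ x
    swap
    · exact ⟨0, fun h => absurd h hx⟩
    have hb : ∀ n, eulerSeq G c (h n) (K x n) ∈ Icc (c - M * x) (c + M * x) := fun n => by
      have h1 := abs_eulerSeq_sub_le (c := c) hM (hh n) 0 (K x n)
      have h0 : eulerSeq G c (h n) 0 = c := rfl
      have h2 : 0 ≤ K x n * h n := mul_nonneg (Nat.cast_nonneg _) (hh n)
      have h3 := mul_le_mul_of_nonneg_left (hKx x hx n) hM0
      rw [h0, Nat.cast_zero, zero_mul, sub_zero, abs_of_nonneg h2, abs_le] at h1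
      constructor <;> linarith
    obtain ⟨l, -, hl⟩ := isCompact_Icc.ultrafilter_le_nhds
      (U.map fun n => eulerSeq G c (h n) (K x n))
      (le_principal_iff.2 (Eventually.of_forall hb : ∀ᶠ n in (U : Filter ℕ), _))
    exact ⟨l, fun _ => hl⟩
  choose w hw using hlim
  refine ⟨w, ?_, fun x hx => ?_⟩
  · refine tendsto_nhds_unique (hw 0 le_rfl) ?_
    simp [K, eulerSeq]
  rw [hasDerivWithinAt_iff_isLittleO, Asymptotics.isLittleO_iff]
  intro ε hε
  obtain ⟨η, hη, hηG⟩ := Metric.continuousAt_iff.1 (hG.continuousAt (x := (x, w x))) ε hε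
  have H : ∀ s u, |s - x| < η → |u - w x| < η → |G (s, u) - G (x, w x)| ≤ ε :=
    fun s u hs hu => (hηG (by
      rw [Prod.dist_eq]; exact max_lt (by rwa [Real.dist_eq]) (by rwa [Real.dist_eq]))).le
  set δ := η / (2 * M + 1) with hδ
  have hδ0 : 0 < δ := by positivity
  have hδη : (2 * M + 1) * δ ≤ η := by rw [hδ]; field_simp; exact le_rfl
  filter_upwards [self_mem_nhdsWithin, mem_nhdsWithin_of_mem_nhds (Metric.ball_mem_nhds x hδ0)]
    with t ht htx
  have ht : 0 ≤ t := ht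
  rw [Metric.mem_ball, Real.dist_eq] at htx
  have hev : ∀ᶠ n in (U : Filter ℕ), |K x n * h n - x| < δ :=
    (hKlim x hx).eventually (Metric.ball_mem_nhds x hδ0)
  have hev' : ∀ᶠ n in (U : Filter ℕ), |K t n * h n - x| < δ :=
    (hKlim t ht).eventually (Metric.isOpen_ball.mem_nhds (x := t) (show t ∈ Metric.ball x δ from htx))
  have hev'' : ∀ᶠ n in (U : Filter ℕ), |eulerSeq G c (h n) (K x n) - w x| < δ :=
    (hw x hx).eventually (Metric.ball_mem_nhds _ hδ0)
  have hd := (hKlim t ht).sub (hKlim x hx)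
  have := le_of_tendsto_of_tendsto (b := (U : Filter ℕ))
    (((hw t ht).sub (hw x hx)).sub (hd.const_mul (G (x, w x)))).abs (hd.abs.const_mul ε) (by
      filter_upwards [hev, hev', hev''] with n h1 h2 h3
      exact abs_eulerSeq_sub_sub_le_of_near hM (hh n) hδη H h1 h2 h3)
  simpa [mul_comm] using this

/-- **Peano's existence theorem**, local form to the right of the initial time. -/
theorem exists_local_hasDerivWithinAt_of_continuousOn {F : ℝ × ℝ → ℝ} {a : ℝ}
    (hF : ContinuousOn F (Ici a ×ˢ univ)) (c : ℝ) :
    ∃ (w : ℝ → ℝ) (b : ℝ), a < b ∧ w a = c ∧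
      ∀ x ∈ Ico a b, HasDerivWithinAt w (F (x, w x)) (Ico a b) x := by
  have hc : c - 1 ≤ c + 1 := by linarith
  let π : ℝ × ℝ → ℝ × ℝ := fun p =>
    ((projIcc a (a + 1) (by linarith) (a + p.1) : ℝ), (projIcc (c - 1) (c + 1) hc p.2 : ℝ))
  have hπ : Continuous π := by
    have h1 := continuous_projIcc (a := a) (b := a + 1) (h := by linarith)
    have h2 := continuous_projIcc (a := c - 1) (b := c + 1) (h := hc)
    fun_prop
  have hπm : ∀ p, π p ∈ Icc a (a + 1) ×ˢ Icc (c - 1) (c + 1) :=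
    fun p => ⟨Subtype.coe_prop _, Subtype.coe_prop _⟩
  have hsub : Icc a (a + 1) ×ˢ Icc (c - 1) (c + 1) ⊆ Ici a ×ˢ (univ : Set ℝ) :=
    prod_mono Icc_subset_Ici_self (subset_univ _)
  obtain ⟨M, hM⟩ := (isCompact_Icc.prod isCompact_Icc).exists_bound_of_continuousOn
    (hF.mono hsub)
  obtain ⟨w, hw0, hw⟩ := exists_hasDerivWithinAt_of_continuous_of_bounded (G := F ∘ π)
    (hF.comp_continuous hπ fun p => hsub (hπm p)) (M := M) (fun p => hM _ (hπm p)) c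
  obtain ⟨r, hr, hwr⟩ := Metric.continuousWithinAt_iff.1 (hw 0 le_rfl).continuousWithinAt 1
    one_pos
  refine ⟨fun t => w (t - a), a + min r 1, by simp [hr], by simpa using hw0, fun x hx => ?_⟩
  have hxr : x - a < r := by linarith [hx.2, min_le_left r 1]
  have hx1 : x - a < 1 := by linarith [hx.2, min_le_right r 1]
  have hx0 : 0 ≤ x - a := sub_nonneg.2 hx.1
  have hwx : |w (x - a) - c| < 1 := by
    have := hwr (x := x - a) hx0 (by simpa [abs_of_nonneg hx0] using hxr)
    rwa [hw0, Real.dist_eq] at this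
  have hπx : π (x - a, w (x - a)) = (x, w (x - a)) := by
    rw [abs_lt] at hwx
    have h1 := projIcc_of_mem (a := a) (b := a + 1) (by linarith)
      (x := a + (x - a)) ⟨by linarith, by linarith⟩
    have h2 := projIcc_of_mem hc (x := w (x - a)) ⟨by linarith, by linarith⟩
    simp only [π, h1, h2]
    simp
  have hd := (hw (x - a) hx0).scomp x (h := fun t => t - a) (s := Ico a (a + min r 1))
    ((hasDerivWithinAt_id x _).sub_const a) fun t ht => sub_nonneg.2 ht.1
  simpa [hπx, Function.comp_def] using hd

theorem exists_mapClusterPt_of_not_tendsto {y : ℝ → ℝ} {b a : ℝ} (hba : b < a)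
    (hy : ContinuousOn y (Ico b a)) (htop : ¬ Tendsto y (𝓝[<] a) atTop)
    (hbot : ¬ Tendsto y (𝓝[<] a) atBot) : ∃ c, MapClusterPt c (𝓝[<] a) y := by
  simp only [tendsto_atTop, tendsto_atBot, not_forall, not_eventually, not_le] at htop hbot
  obtain ⟨A, hA⟩ := htop
  obtain ⟨B, hB⟩ := hbot
  suffices h : ∃ᶠ x in 𝓝[<] a, y x ∈ Icc B (max A B) by
    obtain ⟨c, -, hc⟩ := isCompact_Icc.exists_mapClusterPt_of_frequently h
    exact ⟨c, hc⟩
  refine frequently_iff.2 fun {V} hV => ?_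
  obtain ⟨l, hl, hlV⟩ := (mem_nhdsLT_iff_exists_Ioo_subset' hba).1
    (inter_mem hV (Ioo_mem_nhdsLT hba))
  have hmem := Ioo_mem_nhdsLT (mem_Iio.1 hl)
  obtain ⟨p, hp, hpV⟩ := (hA.and_eventually hmem).exists
  obtain ⟨q, hq, hqV⟩ := (hB.and_eventually hmem).exists
  rcases le_or_gt B (y p) with hBp | hBp
  · exact ⟨p, (hlV hpV).1, hBp, hp.le.trans (le_max_left _ _)⟩
  · have hcont : ContinuousOn y (Ioo l a) :=
      hy.mono fun x hx => Ioo_subset_Ico_self (hlV hx).2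
    obtain ⟨x, hx, hxB⟩ := isPreconnected_Ioo.intermediate_value hpV hqV hcont ⟨hBp.le, hq.le⟩
    exact ⟨x, (hlV hx).1, hxB.ge, hxB.le.trans (le_max_right _ _)⟩

/-- A solution of `y' = F (x, y)` converges to each of its cluster points at the right endpoint. -/
theorem tendsto_of_mapClusterPt {F : ℝ × ℝ → ℝ} {y : ℝ → ℝ} {b a c : ℝ} (hba : b < a)
    (hF : ContinuousWithinAt F (Ico b a ×ˢ univ) (a, c))
    (hy : ∀ x ∈ Ico b a, HasDerivWithinAt y (F (x, y x)) (Ico b a) x)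
    (hc : MapClusterPt c (𝓝[<] a) y) : Tendsto y (𝓝[<] a) (𝓝 c) := by
  set M := |F (a, c)| + 1 with hM
  have hM0 : 0 < M := by positivity
  obtain ⟨r, hr, hFr⟩ := Metric.continuousWithinAt_iff.1 hF 1 one_pos
  have hbound : ∀ x ∈ Ico b a, a - x < r → |y x - c| < r → |F (x, y x)| < M := by
    intro x hx hxr hyr
    have h1 := hFr (x := (x, y x)) ⟨hx, mem_univ _⟩ (by
      rw [Prod.dist_eq, Real.dist_eq, Real.dist_eq]
      exact max_lt (by rwa [abs_sub_comm, abs_of_pos (sub_pos.2 hx.2)]) hyr)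
    rw [Real.dist_eq] at h1
    linarith [abs_sub_abs_le_abs_sub (F (x, y x)) (F (a, c))]
  rw [Metric.tendsto_nhds]
  intro e he
  set ε := min e r / 2 with hε
  have hε0 : 0 < ε := by positivity
  have hεe : ε < e := by linarith [min_le_left e r]
  have hεr : ε < r := by linarith [min_le_right e r]
  have hnear : ∀ᶠ x in 𝓝[<] a, x ∈ Ioo (max b (a - min r (ε / 2 / M))) a :=
    Ioo_mem_nhdsLT (max_lt hba (sub_lt_self _ (by positivity)))
  obtain ⟨p, hpc, hp⟩ :=
    ((mapClusterPt_iff_frequently.1 hc _ (Metric.ball_mem_nhds c (half_pos hε0))).and_eventually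
      hnear).exists
  rw [Metric.mem_ball, Real.dist_eq] at hpc
  obtain ⟨hp1, hpa⟩ := hp
  obtain ⟨hbp, hp2⟩ := max_lt_iff.1 hp1
  have hpr : a - p < r := by linarith [min_le_left r (ε / 2 / M)]
  have hpM : M * (a - p) ≤ ε / 2 := by
    rw [mul_comm, ← le_div_iff₀ hM0]
    linarith [min_le_right r (ε / 2 / M)]
  filter_upwards [Ioo_mem_nhdsLT hpa] with x hx
  have hsub : Icc p x ⊆ Ico b a := fun t ht => ⟨hbp.le.trans ht.1, ht.2.trans_lt hx.2⟩
  have hB : ∀ t ∈ Icc p x, ε / 2 + M * (t - p) ≤ ε := fun t ht => by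
    have := mul_le_mul_of_nonneg_left (sub_le_sub_right (hsub ht).2.le p) hM0.le
    linarith
  have key := image_norm_le_of_norm_deriv_right_lt_deriv_boundary (a := p) (b := x)
    (f := fun t => y t - c) (f' := fun t => F (t, y t))
    (fun t ht => (((hy t (hsub ht)).continuousWithinAt.mono hsub).sub_const c))
    (fun t ht => by
      have ht' := hsub (Ico_subset_Icc_self ht)
      exact ((hy t ht').mono_of_mem_nhdsWithin (mem_of_superset (Ico_mem_nhdsGE ht'.2)
        (Ico_subset_Ico_left ht'.1))).sub_const c)
    (B := fun t => ε / 2 + M * (t - p)) (B' := fun _ => M)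
    (by simpa using hpc.le)
    (fun t => by simpa using (((hasDerivAt_id t).sub_const p).const_mul M).const_add (ε / 2))
    (fun t ht hteq => by
      have ht' := Ico_subset_Icc_self ht
      refine hbound t (hsub ht') (by linarith [ht.1]) ?_
      rw [← Real.norm_eq_abs, hteq]
      exact (hB t ht').trans_lt hεr)
    (right_mem_Icc.2 hx.1.le)
  rw [Real.dist_eq]
  exact (key.trans (hB x (right_mem_Icc.2 hx.1.le))).trans_lt hεe

/-- Gluing two solutions of `y' = F (x, y)` at a common endpoint. -/
theorem hasDerivWithinAt_glue {F : ℝ × ℝ → ℝ} {y w : ℝ → ℝ} {b a d : ℝ} (hba : b < a)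
    (had : a < d) (hF : ContinuousOn F (Ici b ×ˢ univ))
    (hy : ∀ x ∈ Ico b a, HasDerivWithinAt y (F (x, y x)) (Ico b a) x)
    (hyw : Tendsto y (𝓝[<] a) (𝓝 (w a)))
    (hw : ∀ x ∈ Ico a d, HasDerivWithinAt w (F (x, w x)) (Ico a d) x) :
    ∀ x ∈ Ico b d, HasDerivWithinAt (fun t => if t < a then y t else w t)
      (F (x, if x < a then y x else w x)) (Ico b d) x := by
  set z : ℝ → ℝ := fun t => if t < a then y t else w t with hz
  have hzy : ∀ t, t < a → z t = y t := fun t ht => if_pos ht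
  have hzw : ∀ t, a ≤ t → z t = w t := fun t ht => if_neg ht.not_gt
  have hzL : ∀ x ∈ Ico b a, HasDerivWithinAt z (F (x, z x)) (Ico b a) x := fun x hx => by
    rw [hzy x hx.2]
    exact (hy x hx).congr (fun t ht => hzy t ht.2) (hzy x hx.2)
  have hzR : ∀ x ∈ Ico a d, HasDerivWithinAt z (F (x, z x)) (Ico a d) x := fun x hx => by
    rw [hzw x hx.1]
    exact (hw x hx).congr (fun t ht => hzw t ht.1) (hzw x hx.1)
  intro x hx
  change HasDerivWithinAt z (F (x, z x)) (Ico b d) x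
  rcases lt_trichotomy x a with hxa | rfl | hxa
  · refine (hzL x ⟨hx.1, hxa⟩).mono_of_mem_nhdsWithin ?_
    filter_upwards [self_mem_nhdsWithin, mem_nhdsWithin_of_mem_nhds (Iio_mem_nhds hxa)]
      with t ht hta using ⟨ht.1, hta⟩
  · have hlim : Tendsto z (𝓝[<] x) (𝓝 (z x)) := by
      rw [hzw x le_rfl]
      exact hyw.congr' (by filter_upwards [self_mem_nhdsWithin] with t ht using (hzy t ht).symm)
    have hleft : HasDerivWithinAt z (F (x, z x)) (Iic x) x := by
      refine hasDerivWithinAt_Iic_of_tendsto_deriv (s := Ioo b x)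
        (fun t ht => ((hzL t (Ioo_subset_Ico_self ht)).differentiableWithinAt.mono
          Ioo_subset_Ico_self))
        (hlim.mono_left (nhdsWithin_mono _ Ioo_subset_Iio_self)) (Ioo_mem_nhdsLT hba) ?_
      have h1 : Tendsto (fun t => (t, z t)) (𝓝[<] x) (𝓝[Ici b ×ˢ univ] (x, z x)) := by
        refine tendsto_nhdsWithin_iff.2
          ⟨(tendsto_id.mono_left nhdsWithin_le_nhds).prodMk_nhds hlim, ?_⟩
        filter_upwards [Ioo_mem_nhdsLT hba] with t ht using ⟨ht.1.le, mem_univ _⟩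
      refine ((hF (x, z x) ⟨hba.le, mem_univ _⟩).tendsto.comp h1).congr' ?_
      filter_upwards [Ioo_mem_nhdsLT hba] with t ht
      exact (((hzL t (Ioo_subset_Ico_self ht)).hasDerivAt (Ico_mem_nhds ht.1 ht.2)).deriv).symm
    refine (hleft.union (hzR x ⟨le_rfl, had⟩)).mono fun t ht => ?_
    rcases le_total t x with h | h
    · exact Or.inl h
    · exact Or.inr ⟨h, ht.2⟩
  · refine (hzR x ⟨hxa.le, hx.2⟩).mono_of_mem_nhdsWithin ?_
    filter_upwards [self_mem_nhdsWithin, mem_nhdsWithin_of_mem_nhds (Ioi_mem_nhds hxa)]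
      with t ht hta using ⟨le_of_lt hta, ht.2⟩

theorem isSolutionOn_coe_iff {F : ℝ × ℝ → ℝ} {a : ℝ} {y : ℝ → ℝ} :
    IsSolutionOn F a y ↔ 0 < a ∧ y 0 = 0 ∧
      ∀ x ∈ Ico 0 a, HasDerivWithinAt y (F (x, y x)) (Ico 0 a) x := by
  simp only [IsSolutionOn, EReal.coe_pos, EReal.coe_lt_coe_iff, mem_Ico, and_imp]
  rfl

/-- **Blow-up of noncontinuable solutions** (from Theorems 4.1 and 5.3).
Let `F : [0,∞) × ℝ → ℝ` be continuous and `y` a noncontinuable (global) solution of (*)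
on `[0, a)` with `a < ∞`. Then `y x → +∞` or `y x → -∞` as `x → a⁻`. -/
theorem global_solution_blowup (F : ℝ × ℝ → ℝ)
    (hF : ContinuousOn F (Set.Ici (0 : ℝ) ×ˢ (Set.univ : Set ℝ)))
    (a : ℝ) (y : ℝ → ℝ) (hy : IsGlobalSolutionOn F (a : EReal) y) :
    Filter.Tendsto y (nhdsWithin a (Set.Iio a)) Filter.atTop ∨
    Filter.Tendsto y (nhdsWithin a (Set.Iio a)) Filter.atBot := by
  obtain ⟨hsol, hmax⟩ := hy
  obtain ⟨ha, hy0, hyd⟩ := isSolutionOn_coe_iff.1 hsol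
  by_contra hcon
  rw [not_or] at hcon
  obtain ⟨c, hc⟩ := exists_mapClusterPt_of_not_tendsto ha
    (fun x hx => (hyd x hx).continuousWithinAt) hcon.1 hcon.2
  have hlim := tendsto_of_mapClusterPt ha ((hF (a, c) ⟨ha.le, mem_univ _⟩).mono
    (prod_mono_left Ico_subset_Ici_self)) hyd hc
  obtain ⟨w, d, had, rfl, hw⟩ := exists_local_hasDerivWithinAt_of_continuousOn
    (hF.mono (prod_mono_left (Ici_subset_Ici.2 ha.le))) c
  refine hmax ⟨d, fun t => if t < a then y t else w t, EReal.coe_lt_coe_iff.2 had,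
    isSolutionOn_coe_iff.2 ⟨ha.trans had, by simp [ha, hy0],
      hasDerivWithinAt_glue ha had hF hyd hlim hw⟩,
    fun x _ hx => if_pos (EReal.coe_lt_coe_iff.1 hx)⟩
end

section
/- Let a < b be reals and let f : ℝ → ℝ be continuous on [a, b]. Define S : ℝ → ℝ by S(h) = Σ_{i = i_a}^{i_b} f(i·h)·h for h > 0, where i_a is the unique integer with i_a·h − h < a ≤ i_a·h and i_b is the unique integer with i_b·h < b ≤ i_b·h + h, and S(h) = 0 for h ≤ 0. Then for every positive infinitesimal hyperreal h, the hyperreal extension S*(h) satisfies IsSt (S*(h)) (∫_a^b f(x) dx); that is, the standard part of S*(h) equals the Riemann integral of f over [a, b]. -/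
open scoped Hyperreal

/-- The Riemann sum `Σ_{i = i_a}^{i_b} f(i·h)·h` over the grid `{i·h : i ∈ ℤ}` with
step `h > 0`, where `i_a = ⌈a/h⌉` is the unique integer with `i_a·h - h < a ≤ i_a·h`
and `i_b = ⌈b/h⌉ - 1` is the unique integer with `i_b·h < b ≤ i_b·h + h`; set to `0`
for `h ≤ 0`. -/
noncomputable def riemannSum (f : ℝ → ℝ) (a b : ℝ) (h : ℝ) : ℝ :=
  if 0 < h then ∑ i ∈ Finset.Icc ⌈a / h⌉ (⌈b / h⌉ - 1), f (i * h) * h else 0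

open intervalIntegral in
/-- A grid Riemann sum of a continuous function differs from the integral over the union of its
grid cells by at most the length of that union times the oscillation over a cell. -/
lemma abs_sum_Ico_mul_sub_integral_le {F : ℝ → ℝ} (hF : Continuous F) {h η : ℝ} (hh : 0 ≤ h)
    (hη : ∀ x y, |x - y| ≤ h → |F x - F y| ≤ η) {m n : ℤ} (hmn : m ≤ n) :
    |∑ i ∈ Finset.Ico m n, F (i * h) * h - ∫ x in (m * h)..(n * h), F x| ≤ (n - m) * h * η := by
  induction n, hmn using Int.leInduction with
  | base => simp
  | succ n hmn ih =>
    have hle : (n : ℝ) * h ≤ ((n + 1 : ℤ) : ℝ) * h := by push_cast; nlinarith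
    have hcell : |F (n * h) * h - ∫ x in (n * h)..((n + 1 : ℤ) * h), F x| ≤ η * h := by
      have hlen : ((n + 1 : ℤ) : ℝ) * h - n * h = h := by push_cast; ring
      have hconst : F (n * h) * h = ∫ _ in (n * h)..((n + 1 : ℤ) * h), F (n * h) := by
        rw [integral_const, hlen, smul_eq_mul, mul_comm]
      rw [hconst, ← integral_sub intervalIntegrable_const (hF.intervalIntegrable _ _),
        ← Real.norm_eq_abs]
      refine (norm_integral_le_of_norm_le_const (C := η) fun x hx => ?_).trans_eq ?_
      · rw [Set.uIoc_of_le hle] at hx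
        refine hη _ _ ?_
        rw [abs_sub_comm, abs_of_nonneg (by linarith [hx.1])]
        linarith [hx.2]
      · rw [hlen, abs_of_nonneg hh]
    rw [← Finset.insert_Ico_right_eq_Ico_add_one hmn, Finset.sum_insert (by simp),
      ← integral_add_adjacent_intervals (hF.intervalIntegrable (m * h) (n * h))
        (hF.intervalIntegrable _ _)]
    calc _ = |(F (n * h) * h - ∫ x in (n * h)..((n + 1 : ℤ) * h), F x) +
          (∑ i ∈ Finset.Ico m n, F (i * h) * h - ∫ x in (m * h)..(n * h), F x)| := by
          congr 1; ring
      _ ≤ η * h + (n - m) * h * η := (abs_add_le _ _).trans (add_le_add hcell ih)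
      _ = _ := by push_cast; ring

open Filter Topology in
lemma tendsto_ceil_div_mul_self (a : ℝ) :
    Tendsto (fun h : ℝ => (⌈a / h⌉ : ℝ) * h) (𝓝[>] 0) (𝓝 a) := by
  have hup : Tendsto (fun h : ℝ => a + h) (𝓝[>] 0) (𝓝 a) := by
    have : Tendsto (fun h : ℝ => a + h) (𝓝 0) (𝓝 (a + 0)) := tendsto_id.const_add a
    rw [add_zero] at this
    exact this.mono_left nhdsWithin_le_nhds
  refine tendsto_of_tendsto_of_tendsto_of_le_of_le' tendsto_const_nhds hup ?_ ?_
  all_goals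
    filter_upwards [self_mem_nhdsWithin] with h hh
    rw [Set.mem_Ioi] at hh
    have hdiv : a / h * h = a := div_mul_cancel₀ a hh.ne'
  · nlinarith [Int.le_ceil (a / h)]
  · nlinarith [Int.ceil_lt_add_one (a / h)]

lemma riemannSum_congr {f g : ℝ → ℝ} {a b : ℝ} (hfg : Set.EqOn f g (Set.Icc a b)) (h : ℝ) :
    riemannSum f a b h = riemannSum g a b h := by
  unfold riemannSum
  split_ifs with hh
  · refine Finset.sum_congr rfl fun i hi => ?_
    rw [Finset.mem_Icc] at hi
    have hi₂ : (i : ℝ) < b / h := Int.lt_ceil.1 (by lia)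
    rw [hfg ⟨(div_le_iff₀ hh).1 (Int.ceil_le.1 hi.1), ((lt_div_iff₀ hh).1 hi₂).le⟩]
  · rfl

open Filter Topology in
lemma tendsto_riemannSum_of_uniformContinuous {F : ℝ → ℝ} (hF : UniformContinuous F) {a b : ℝ}
    (hab : a ≤ b) : Tendsto (riemannSum F a b) (𝓝[>] 0) (𝓝 (∫ x in a..b, F x)) := by
  have hint := hF.continuous.intervalIntegrable (μ := MeasureTheory.volume)
  have hA := tendsto_ceil_div_mul_self a
  have hB := tendsto_ceil_div_mul_self b
  have hprim : Continuous fun x => ∫ t in (0 : ℝ)..x, F t :=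
    intervalIntegral.continuous_primitive hint 0
  have hgrid : Tendsto (fun h : ℝ => ∫ x in (⌈a / h⌉ * h)..(⌈b / h⌉ * h), F x) (𝓝[>] 0)
      (𝓝 (∫ x in a..b, F x)) := by
    have := ((hprim.tendsto b).comp hB).sub ((hprim.tendsto a).comp hA)
    simpa only [Function.comp_def,
      intervalIntegral.integral_interval_sub_left (hint _ _) (hint _ _)] using this
  have herr : Tendsto (fun h : ℝ => riemannSum F a b h -
      ∫ x in (⌈a / h⌉ * h)..(⌈b / h⌉ * h), F x) (𝓝[>] 0) (𝓝 0) := by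
    rw [Metric.tendsto_nhds]
    intro η hη
    have hL : 0 < b - a + 1 := by linarith
    obtain ⟨δ, hδ, hFδ⟩ := Metric.uniformContinuous_iff.1 hF (η / (b - a + 1)) (by positivity)
    have hlen : ∀ᶠ h : ℝ in 𝓝[>] 0, (⌈b / h⌉ : ℝ) * h - ⌈a / h⌉ * h < b - a + 1 :=
      (hB.sub hA).eventually_lt_const (by linarith)
    filter_upwards [hlen, Ioo_mem_nhdsGT hδ] with h hlen hh
    have hle : ⌈a / h⌉ ≤ ⌈b / h⌉ :=
      Int.ceil_le_ceil (div_le_div_of_nonneg_right hab hh.1.le)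
    have key := abs_sum_Ico_mul_sub_integral_le hF.continuous hh.1.le
      (fun x y hxy => (hFδ (hxy.trans_lt hh.2)).le) hle
    have hsum : riemannSum F a b h = ∑ i ∈ Finset.Ico ⌈a / h⌉ ⌈b / h⌉, F (i * h) * h := by
      rw [riemannSum, if_pos hh.1, Finset.Icc_sub_one_right_eq_Ico]
    rw [hsum, Real.dist_0_eq_abs]
    refine key.trans_lt ?_
    rw [sub_mul]
    calc _ < (b - a + 1) * (η / (b - a + 1)) := by gcongr
      _ = η := mul_div_cancel₀ η hL.ne'
  simpa using herr.add hgrid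

open Filter Topology in
/-- Grid Riemann sums of a function continuous on `[a, b]` converge to its integral. -/
lemma tendsto_riemannSum {f : ℝ → ℝ} {a b : ℝ} (hab : a ≤ b)
    (hf : ContinuousOn f (Set.Icc a b)) :
    Tendsto (riemannSum f a b) (𝓝[>] 0) (𝓝 (∫ x in a..b, f x)) := by
  set F := Set.IccExtend hab ((Set.Icc a b).domRestrict f) with hFdef
  have hF : UniformContinuous F :=
    (CompactSpace.uniformContinuous_of_continuous hf.domRestrict).comp
      (LipschitzWith.projIcc hab).uniformContinuous
  have heq : Set.EqOn f F (Set.Icc a b) := fun x hx => by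
    rw [hFdef, Set.IccExtend_of_mem hab _ hx, Set.domRestrict_apply]
  have hint : ∫ x in a..b, f x = ∫ x in a..b, F x :=
    intervalIntegral.integral_congr (by rwa [Set.uIcc_of_le hab])
  rw [funext (riemannSum_congr heq), hint]
  exact tendsto_riemannSum_of_uniformContinuous hF hab

/-- **Infinitesimal-step Riemann sums compute the integral** (Definition 3.1).
Let `a < b` and `f` continuous on `[a, b]`. For every positive infinitesimal
hyperreal `h`, the hyperreal extension of the Riemann-sum function evaluated at `h`
has standard part equal to `∫ x in a..b, f x`. -/
theorem riemannSum_infinitesimal_isSt (a b : ℝ) (hab : a < b) (f : ℝ → ℝ)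
    (hf : ContinuousOn f (Set.Icc a b)) (h : ℝ*)
    (hpos : 0 < h) (hinf : Hyperreal.Infinitesimal h) :
    Hyperreal.IsSt (Filter.Germ.map (riemannSum f a b) h) (∫ x in a..b, f x) := by
  obtain ⟨u, rfl⟩ := Hyperreal.ofSeq_surjective h
  have hu : Filter.Tendsto u (Filter.hyperfilter ℕ) (nhdsWithin 0 (Set.Ioi 0)) :=
    tendsto_nhdsWithin_iff.2
      ⟨Hyperreal.isSt_ofSeq_iff_tendsto.1 hinf, Hyperreal.ofSeq_lt_ofSeq.1 hpos⟩
  exact Hyperreal.isSt_ofSeq_iff_tendsto.2 ((tendsto_riemannSum hab.le hf).comp hu)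
end

section
/- Let D be a set of hyperreals, w : ℝ* → ℝ* a function, and I ⊆ ℝ. Assume (density) for every x ∈ I there is α ∈ D with α − x infinitesimal, and (S-continuity) for all α, β ∈ D, if α − β is infinitesimal then w(α) − w(β) is infinitesimal. Then there exists a set W ⊆ ℝ × ℝ which is the graph of a function (i.e., (x,y₁) ∈ W and (x,y₂) ∈ W imply y₁ = y₂) such that for all reals x, y: (x, y) ∈ W if and only if there exists α ∈ D with IsSt α x and IsSt (w α) y. -/
open scoped Hyperreal

/-- **Standardization of S-continuous densely defined functions** (Proposition 3.7,
hyperreal rendering). Let `D` be a set of hyperreals, `w : ℝ* → ℝ*`, and `I ⊆ ℝ`.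
Assume density: every `x ∈ I` has some `α ∈ D` with `α - x` infinitesimal; and
S-continuity: `α, β ∈ D` with `α - β` infinitesimal have `w α - w β` infinitesimal.
Then there is a set `W ⊆ ℝ × ℝ` which is the graph of a function and such that for all
reals `x, y`: `(x, y) ∈ W` iff there is `α ∈ D` with `IsSt α x` and `IsSt (w α) y`. -/
theorem standardization_of_scontinuous (D : Set ℝ*) (w : ℝ* → ℝ*) (I : Set ℝ)
    (hdense : ∀ x ∈ I, ∃ α ∈ D, Hyperreal.Infinitesimal (α - (x : ℝ*)))
    (hScont : ∀ α ∈ D, ∀ β ∈ D,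
      Hyperreal.Infinitesimal (α - β) → Hyperreal.Infinitesimal (w α - w β)) :
    ∃ W : Set (ℝ × ℝ),
      (∀ x y₁ y₂ : ℝ, (x, y₁) ∈ W → (x, y₂) ∈ W → y₁ = y₂) ∧
      (∀ x y : ℝ, (x, y) ∈ W ↔
        ∃ α ∈ D, Hyperreal.IsSt α x ∧ Hyperreal.IsSt (w α) y) := by
  refine ⟨{p | ∃ α ∈ D, Hyperreal.IsSt α p.1 ∧ Hyperreal.IsSt (w α) p.2}, ?_, fun _ _ => Iff.rfl⟩
  rintro x y₁ y₂ ⟨α, hα, hαx, hwα⟩ ⟨β, hβ, hβx, hwβ⟩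
  have hαβ : Hyperreal.Infinitesimal (α - β) := by
    simpa only [Hyperreal.Infinitesimal, sub_self] using hαx.sub hβx
  exact sub_eq_zero.mp ((hwα.sub hwβ).unique (hScont α hα β hβ hαβ))
end
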